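/- Let k be the degree of the polynomial p(z) and let u belong to F(p,rho). Set M := max of rho and the integers rhobar_{Delta^i p} for 1 <= i <= k; rhotilde_u := min{t >= rhobar_{Delta p} : f^t_{Delta p}(s) <= Delta u(s) for all s}; and mtilde := m_{f^{rhotilde_u}_{Delta p}}. If k = 0, then m_u = rho + 1. If k > 0, then m_u = max{mtilde, rho + 1}. Moreover, in all cases M + 1 <= m_u <= M + 2. -/

import Mathlib

open scoped Classical

noncomputable section

/-! ## Binomial expansions and the Macaulay operations `(a_t)^+_+` and `(a_t)^-_-` -/

/-- The largest `k` such that `C(k,t) ≤ a` (top coefficient of the greedy binomial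
expansion of `a` in base `t`). -/
def expTop (a t : ℕ) : ℕ := Nat.findGreatest (fun k => Nat.choose k t ≤ a) (a + t + 1)

/-- `(a_t)^+_+` : if `a = C(k(t),t) + ... + C(k(j),j)` is the binomial expansion of `a`
in base `t`, then `plusPlus a t = C(k(t)+1,t+1) + ... + C(k(j)+1,j+1)`; it sends `0` to `0`. -/
def plusPlus : ℕ → ℕ → ℕ
  | _, 0 => 0
  | a, t + 1 =>
    if a = 0 then 0
    else Nat.choose (expTop a (t + 1) + 1) (t + 2) +
      plusPlus (a - Nat.choose (expTop a (t + 1)) (t + 1)) t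

/-- `(a_t)^-_-` : if `a = C(k(t),t) + ... + C(k(j),j)` is the binomial expansion of `a`
in base `t`, then `minusMinus a t = C(k(t)-1,t-1) + ... + C(k(j)-1,j-1)`; it sends `0` to `0`. -/
def minusMinus : ℕ → ℕ → ℕ
  | _, 0 => 0
  | a, t + 1 =>
    if a = 0 then 0
    else Nat.choose (expTop a (t + 1) - 1) t +
      minusMinus (a - Nat.choose (expTop a (t + 1)) (t + 1)) t

/-! ## Numerical functions -/

/-- A numerical function (modelled with values in `ℤ`) is *admissible* (an O-sequence) if it is
nonnegative, `H 0 = 1` and `H (t+1) ≤ (H(t)_t)^+_+` for every `t ≥ 1`. -/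
def OSeq (H : ℕ → ℤ) : Prop :=
  (∀ t, 0 ≤ H t) ∧ H 0 = 1 ∧ ∀ t, 1 ≤ t → H (t + 1) ≤ (plusPlus (H t).toNat t : ℤ)

/-- First derivative of a numerical function: `Δf(0) = 1`, `Δf(t) = f(t) - f(t-1)`. -/
def nderiv (f : ℕ → ℤ) : ℕ → ℤ
  | 0 => 1
  | t + 1 => f (t + 1) - f t

/-- Integral of a numerical function: `Σg(0) = 1`, `Σg(t) = Σg(t-1) + g(t)`. -/
def ninteg (g : ℕ → ℤ) : ℕ → ℤ
  | 0 => 1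
  | t + 1 => ninteg g t + g (t + 1)

/-! ## Admissible Hilbert polynomials in Gotzmann form -/

/-- The integer-valued binomial coefficient `C(a,k)` for `a : ℤ`, agreeing with the
polynomial binomial coefficient `a(a-1)⋯(a-k+1)/k!`. -/
def zchoose (a : ℤ) (k : ℕ) : ℤ :=
  if 0 ≤ a then (a.toNat.choose k : ℤ)
  else (-1) ^ k * (((k : ℤ) - 1 - a).toNat.choose k : ℤ)

/-- An admissible Hilbert polynomial, recorded through its Gotzmann form
`p(z) = C(z+k₁,k₁) + C(z+k₂-1,k₂) + ... + C(z+k_r-(r-1),k_r)` with `k₁ ≥ k₂ ≥ ... ≥ k_r ≥ 0`. -/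
structure GotzmannPoly where
  ks : List ℕ
  sorted : ks.Pairwise (· ≥ ·)

namespace GotzmannPoly

/-- The Gotzmann number `r` of `p`. -/
def r (p : GotzmannPoly) : ℕ := p.ks.length

/-- The degree of `p`, namely `k₁`. -/
def degree (p : GotzmannPoly) : ℕ := p.ks.headD 0

/-- Evaluation of `p` at an integer. -/
def eval (p : GotzmannPoly) (z : ℤ) : ℤ :=
  ∑ i ∈ Finset.range p.r, zchoose (z + (p.ks.getD i 0 : ℤ) - i) (p.ks.getD i 0)

/-- The first difference `Δp(z) = p(z) - p(z-1)`, in Gotzmann form. -/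
def delta (p : GotzmannPoly) : GotzmannPoly where
  ks := (p.ks.filter fun k => 1 ≤ k).map fun k => k - 1
  sorted := by
    refine List.Pairwise.map _ (fun {a b} h => Nat.sub_le_sub_right h 1) ?_
    exact p.sorted.filter _

/-- Iterated first difference `Δ^i p`. -/
def deltaIter (p : GotzmannPoly) (i : ℕ) : GotzmannPoly := delta^[i] p

/-- The polynomial `p(z) + c`, in Gotzmann form. -/
def addConst (p : GotzmannPoly) (c : ℕ) : GotzmannPoly where
  ks := p.ks ++ List.replicate c 0
  sorted := by
    rw [List.pairwise_append]
    refine ⟨p.sorted, ?_, ?_⟩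
    · exact List.pairwise_replicate.2 (Or.inr le_rfl)
    · intro a _ b hb
      rw [List.eq_of_mem_replicate hb]
      exact Nat.zero_le a

end GotzmannPoly

/-- The set `Π_p = {1 ≤ t ≤ r : (p(t+h)_{t+h})^+_+ ≥ p(t+h+1) ≥ 1 for all h ≥ 0}`. -/
def PiSet (p : GotzmannPoly) : Set ℕ :=
  {t | 1 ≤ t ∧ t ≤ p.r ∧ ∀ h : ℕ,
      p.eval ((t : ℤ) + (h : ℤ) + 1) ≤ (plusPlus (p.eval ((t : ℤ) + (h : ℤ))).toNat (t + h) : ℤ) ∧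
      1 ≤ p.eval ((t : ℤ) + (h : ℤ) + 1)}

/-- `ρ_p`: `0` if `min Π_p = 1` and `p(0) = 1`, and `min Π_p` otherwise. -/
def rhoP (p : GotzmannPoly) : ℕ :=
  if sInf (PiSet p) = 1 ∧ p.eval 0 = 1 then 0 else sInf (PiSet p)

/-- The minimal function `f^ρ_p` : `f(t) = p(t)` for `t ≥ ρ` and
`f(t) = ((f(t+1))_{t+1})^-_-` for `t < ρ`. -/
def fmin (p : GotzmannPoly) (ρ : ℕ) (t : ℕ) : ℤ :=
  if h : ρ ≤ t then p.eval (t : ℤ)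
  else (minusMinus (fmin p ρ (t + 1)).toNat (t + 1) : ℤ)
termination_by ρ - t
decreasing_by omega

/-- The function `g^ρ_p` : `g(t) = p(t)` for `t ≥ ρ`, `g(ρ-1) = p(ρ-1) + 1` and
`g(t) = ((g(t+1))_{t+1})^-_-` for `t < ρ-1`. -/
def gmin (p : GotzmannPoly) (ρ : ℕ) (t : ℕ) : ℤ :=
  if h : ρ ≤ t then p.eval (t : ℤ)
  else if t = ρ - 1 then p.eval (t : ℤ) + 1
  else (minusMinus (gmin p ρ (t + 1)).toNat (t + 1) : ℤ)
termination_by ρ - t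
decreasing_by omega

/-- `H` has regularity `ρ` (with respect to the Hilbert polynomial `p`): `ρ` is the least
integer such that `H(t) = p(t)` for all `t ≥ ρ`. -/
def IsRegOf (p : GotzmannPoly) (H : ℕ → ℤ) (ρ : ℕ) : Prop :=
  (∀ t : ℕ, ρ ≤ t → H t = p.eval (t : ℤ)) ∧
  ∀ ρ' : ℕ, (∀ t : ℕ, ρ' ≤ t → H t = p.eval (t : ℤ)) → ρ ≤ ρ'

/-- `H` has Hilbert polynomial `p`, i.e. eventually agrees with `p`. -/
def HasHP (p : GotzmannPoly) (H : ℕ → ℤ) : Prop :=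
  ∃ N : ℕ, ∀ t : ℕ, N ≤ t → H t = p.eval (t : ℤ)

/-- `F(p,ρ)`: the set of Hilbert functions of closed projective subschemes (i.e. numerical
functions which are admissible together with their first derivative) with Hilbert
polynomial `p` and regularity `ρ`. -/
def Fset (p : GotzmannPoly) (ρ : ℕ) : Set (ℕ → ℤ) :=
  {H | OSeq H ∧ OSeq (nderiv H) ∧ IsRegOf p H ρ}

/-- `ρ̄_p`: the minimal `ρ` such that `F(p,ρ)` is non-empty. -/
def rhobar (p : GotzmannPoly) : ℕ := sInf {ρ | (Fset p ρ).Nonempty}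

/-! ## Monomial ideals in `K[x₀,…,xₙ]` (combinatorial model) -/

/-- Monomials of `K[x₀,…,xₙ]`, as exponent vectors. -/
abbrev Mon (n : ℕ) := Fin (n + 1) → ℕ

/-- Degree of a monomial. -/
def mdeg {n : ℕ} (m : Mon n) : ℕ := ∑ i, m i

/-- `T_t`, the set of terms of degree `t`. -/
def Tset (n t : ℕ) : Set (Mon n) := {m | mdeg m = t}

/-- A set of monomials closed under multiplication by arbitrary monomials (a monomial ideal). -/
def MonIdeal {n : ℕ} (J : Set (Mon n)) : Prop :=
  ∀ m ∈ J, ∀ m' : Mon n, m + m' ∈ J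

/-- The elementary Borel move sending `x^m` to `x_i · x^m / x_j`. -/
def borelStep {n : ℕ} (m : Mon n) (j i : Fin (n + 1)) : Mon n :=
  fun l => if l = j then m l - 1 else if l = i then m l + 1 else m l

/-- One elementary Borel move `x_j ↦ x_i` with `j < i`. -/
def borelMove {n : ℕ} (a b : Mon n) : Prop :=
  ∃ j i : Fin (n + 1), j < i ∧ 1 ≤ a j ∧ b = borelStep a j i

/-- The Borel (partial) order `≤_B` on monomials. -/
def borelLE {n : ℕ} : Mon n → Mon n → Prop := Relation.ReflTransGen borelMove

/-- A strongly stable (Borel) monomial ideal. -/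
def StronglyStable {n : ℕ} (J : Set (Mon n)) : Prop :=
  MonIdeal J ∧ ∀ m ∈ J, ∀ j i : Fin (n + 1), j < i → 1 ≤ m j → borelStep m j i ∈ J

/-- A Borel set in `T_t`: a set of degree-`t` monomials closed upwards under `≤_B`. -/
def IsBorelSet {n : ℕ} (t : ℕ) (B : Set (Mon n)) : Prop :=
  B ⊆ Tset n t ∧ ∀ a ∈ B, ∀ b : Mon n, borelLE a b → b ∈ B

/-- Saturation of a monomial ideal:
`J^sat = {m : for every i there is k with x_i^k · m ∈ J}`. -/
def monSat {n : ℕ} (J : Set (Mon n)) : Set (Mon n) :=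
  {m | ∀ i : Fin (n + 1), ∃ k : ℕ, (fun l => if l = i then m l + k else m l) ∈ J}

/-- The monomial ideal generated by a set of monomials. -/
def genIdeal {n : ℕ} (B : Set (Mon n)) : Set (Mon n) :=
  {m | ∃ b ∈ B, ∃ c : Mon n, m = b + c}

/-- The Hilbert function of `S/J` for a monomial ideal `J`: the number of degree-`t`
monomials outside `J`. -/
def hilb {n : ℕ} (J : Set (Mon n)) (t : ℕ) : ℕ :=
  Set.ncard {m : Mon n | mdeg m = t ∧ m ∉ J}

/-- `m / x_i` as an exponent vector. -/
def shrinkAt {n : ℕ} (m : Mon n) (i : Fin (n + 1)) : Mon n :=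
  fun l => if l = i then m l - 1 else m l

/-- `m` is a minimal (monomial) generator of the monomial ideal `J`. -/
def IsMinGen {n : ℕ} (J : Set (Mon n)) (m : Mon n) : Prop :=
  m ∈ J ∧ ∀ i : Fin (n + 1), 1 ≤ m i → shrinkAt m i ∉ J

/-- The Castelnuovo–Mumford regularity of a strongly stable ideal: the maximal degree of a
minimal monomial generator. -/
def monReg {n : ℕ} (J : Set (Mon n)) : ℕ :=
  sSup {d | ∃ m : Mon n, IsMinGen J m ∧ mdeg m = d}

/-- `m_u`: the minimal Castelnuovo–Mumford regularity of a closed projective subscheme with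
Hilbert function `u`, i.e. the minimum of `reg J` over all `n` and all saturated strongly
stable ideals `J ⊆ K[x₀,…,xₙ]` with `H_{S/J} = u`. -/
def mReg (u : ℕ → ℤ) : ℕ :=
  sInf {r | ∃ (n : ℕ) (J : Set (Mon n)), StronglyStable J ∧ monSat J = J ∧
      (∀ t : ℕ, (hilb J t : ℤ) = u t) ∧ monReg J = r}

/-- `M(p,ρ) = {m_u : u ∈ F(p,ρ)}`. -/
def Mset (p : GotzmannPoly) (ρ : ℕ) : Set ℕ := {r | ∃ u ∈ Fset p ρ, mReg u = r}

/-- `m^ρ_p = min M(p,ρ)`. -/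
def mRho (p : GotzmannPoly) (ρ : ℕ) : ℕ := sInf (Mset p ρ)

/-- `m_p`: the minimal Castelnuovo–Mumford regularity of schemes with Hilbert polynomial `p`. -/
def mP (p : GotzmannPoly) : ℕ := sInf {r | ∃ ρ : ℕ, ∃ u ∈ Fset p ρ, mReg u = r}

/-! ## Lex segments and growth-height-lexicographic Borel sets -/

/-- `a` is smaller than `b` in the deglex order (for monomials of the same degree):
`a k < b k` where `k` is the largest index where they differ. -/
def deglexLT {n : ℕ} (a b : Mon n) : Prop :=
  ∃ k : Fin (n + 1), a k < b k ∧ ∀ l : Fin (n + 1), k < l → a l = b l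

/-- A lex-segment of `T_t`: a set of degree-`t` monomials consisting of the highest terms
with respect to deglex. -/
def IsLexSeg {n : ℕ} (t : ℕ) (L : Set (Mon n)) : Prop :=
  L ⊆ Tset n t ∧ ∀ a ∈ L, ∀ b ∈ Tset n t, deglexLT a b → b ∈ L

/-- A lex-segment in `A ⊆ T_t`: the intersection of a lex-segment of `T_t` with `A`. -/
def LexSegIn {n : ℕ} (t : ℕ) (A S : Set (Mon n)) : Prop :=
  ∃ L : Set (Mon n), IsLexSeg t L ∧ S = L ∩ A

/-- The growth class `B^{(i)} = {m ∈ B : min(m) = i}`. -/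
def growthClass {n : ℕ} (B : Set (Mon n)) (i : Fin (n + 1)) : Set (Mon n) :=
  {m | m ∈ B ∧ 1 ≤ m i ∧ ∀ j : Fin (n + 1), j < i → m j = 0}

/-- The height class `B(i) = {m ∈ B : the exponent of x₀ in m is i}`. -/
def heightClass {n : ℕ} (B : Set (Mon n)) (i : ℕ) : Set (Mon n) :=
  {m | m ∈ B ∧ m 0 = i}

/-- A Borel set `B ⊆ T_t` is growth-lexicographic if all its growth classes are lex-segments
in the corresponding growth classes of `T_t`. -/
def GrowthLex {n : ℕ} (t : ℕ) (B : Set (Mon n)) : Prop :=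
  ∀ i : Fin (n + 1), LexSegIn t (growthClass (Tset n t) i) (growthClass B i)

/-- A Borel set `B ⊆ T_t` is growth-height-lexicographic if `B(0)` is growth-lexicographic
and `B(i)` is a lex-segment in `T_t(i)` for every `0 < i ≤ t`. -/
def GHLex {n : ℕ} (t : ℕ) (B : Set (Mon n)) : Prop :=
  GrowthLex t (heightClass B 0) ∧
  ∀ i : ℕ, 0 < i → i ≤ t → LexSegIn t (heightClass (Tset n t) i) (heightClass B i)

end

theorem lt_choose_add (a t : ℕ) : a < (a + (t + 1)).choose (t + 1) := by
  induction t with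
  | zero => simp
  | succ t ih =>
    have h := Nat.choose_succ_succ (a + (t + 1)) (t + 1)
    have e : a + (t + 1 + 1) = (a + (t + 1)).succ := by omega
    rw [e, h]
    omega

theorem expTop_spec (a t : ℕ) :
    (expTop a (t + 1)).choose (t + 1) ≤ a ∧ a < (expTop a (t + 1) + 1).choose (t + 1) := by
  have h1 : (expTop a (t + 1)).choose (t + 1) ≤ a :=
    Nat.findGreatest_spec (P := fun k => Nat.choose k (t + 1) ≤ a) (m := 0) (by omega) (by simp)
  refine ⟨h1, ?_⟩
  by_contra! h2
  rcases le_or_gt (expTop a (t + 1) + 1) (a + (t + 1) + 1) with h | h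
  · have := Nat.le_findGreatest (P := fun k => Nat.choose k (t + 1) ≤ a) h h2
    unfold expTop at this
    omega
  · have h3 : (a + (t + 1)).choose (t + 1) ≤ (expTop a (t + 1)).choose (t + 1) :=
      Nat.choose_le_choose _ (by omega)
    have := lt_choose_add a t
    omega

theorem expTop_eq {a t k : ℕ} (h1 : k.choose (t + 1) ≤ a) (h2 : a < (k + 1).choose (t + 1)) :
    expTop a (t + 1) = k := by
  obtain ⟨h3, h4⟩ := expTop_spec a t
  apply le_antisymm
  · by_contra! h
    have := Nat.choose_le_choose (t + 1) (Nat.succ_le_of_lt h)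
    simp only [Nat.succ_eq_add_one] at this
    omega
  · by_contra! h
    have := Nat.choose_le_choose (t + 1) (Nat.succ_le_of_lt h)
    simp only [Nat.succ_eq_add_one] at this
    omega

@[simp] theorem plusPlus_zero (t : ℕ) : plusPlus 0 t = 0 := by
  cases t <;> simp [plusPlus]

@[simp] theorem minusMinus_zero (t : ℕ) : minusMinus 0 t = 0 := by
  cases t <;> simp [minusMinus]

@[simp] theorem plusPlus_base (a : ℕ) : plusPlus a 0 = 0 := by simp [plusPlus]

@[simp] theorem minusMinus_base (a : ℕ) : minusMinus a 0 = 0 := by simp [minusMinus]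

theorem expTop_choose_add {t k b : ℕ} (hb : b < k.choose t) :
    expTop (k.choose (t + 1) + b) (t + 1) = k := by
  apply expTop_eq (by omega)
  rw [Nat.choose_succ_succ']
  omega

theorem plusPlus_choose_add {t k b : ℕ} (hk : t + 1 ≤ k) (hb : b < k.choose t) :
    plusPlus (k.choose (t + 1) + b) (t + 1) = (k + 1).choose (t + 2) + plusPlus b t := by
  have h0 : 0 < k.choose (t + 1) := Nat.choose_pos hk
  rw [plusPlus, if_neg (by omega), expTop_choose_add hb]
  simp

theorem minusMinus_choose_add {t k b : ℕ} (hk : t + 1 ≤ k) (hb : b < k.choose t) :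
    minusMinus (k.choose (t + 1) + b) (t + 1) = (k - 1).choose t + minusMinus b t := by
  have h0 : 0 < k.choose (t + 1) := Nat.choose_pos hk
  rw [minusMinus, if_neg (by omega), expTop_choose_add hb]
  simp

theorem exists_choose_add {a : ℕ} (ha : 0 < a) (t : ℕ) :
    ∃ k b, t + 1 ≤ k ∧ b < k.choose t ∧ a = k.choose (t + 1) + b := by
  obtain ⟨h1, h2⟩ := expTop_spec a t
  refine ⟨expTop a (t + 1), a - (expTop a (t + 1)).choose (t + 1), ?_, ?_, by omega⟩
  · by_contra! h
    have := Nat.choose_le_choose (t + 1) (Nat.succ_le_of_lt h)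
    simp at this
    omega
  · rw [Nat.choose_succ_succ'] at h2
    omega

theorem plusPlus_lt {t : ℕ} : ∀ {a k : ℕ}, t ≤ k → a < k.choose t →
    plusPlus a t < (k + 1).choose (t + 1) := by
  induction t with
  | zero => intro a k _ _; simp
  | succ t ih =>
    intro a k hk ha
    rcases Nat.eq_zero_or_pos a with rfl | h0
    · simpa using Nat.choose_pos (by omega)
    obtain ⟨l, b, hl, hb, rfl⟩ := exists_choose_add h0 t
    rw [plusPlus_choose_add hl hb]
    have hlk : l < k := by
      by_contra! h
      have := Nat.choose_le_choose (t + 1) h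
      omega
    have h1 := ih (by omega) hb
    have h2 := Nat.choose_le_choose (t + 1 + 1) (show l + 1 + 1 ≤ k + 1 by omega)
    rw [Nat.choose_succ_succ'] at h2
    simp only [add_assoc, Nat.reduceAdd] at *
    omega

theorem minusMinus_le_choose {t : ℕ} : ∀ {a k : ℕ}, t + 1 ≤ k → a < k.choose (t + 1) →
    minusMinus a (t + 1) ≤ (k - 1).choose t := by
  induction t with
  | zero =>
    intro a k hk ha
    rcases Nat.eq_zero_or_pos a with rfl | h0
    · simp
    obtain ⟨l, b, hl, hb, rfl⟩ := exists_choose_add h0 0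
    rw [minusMinus_choose_add hl hb]
    simp
  | succ t ih =>
    intro a k hk ha
    rcases Nat.eq_zero_or_pos a with rfl | h0
    · simp
    obtain ⟨l, b, hl, hb, rfl⟩ := exists_choose_add h0 (t + 1)
    rw [minusMinus_choose_add hl hb]
    have hlk : l < k := by
      by_contra! h
      have := Nat.choose_le_choose (t + 1 + 1) h
      omega
    have h1 := ih (by omega) hb
    have h2 := Nat.choose_le_choose (t + 1) (show l - 1 + 1 ≤ k - 1 by omega)
    rw [Nat.choose_succ_succ'] at h2
    simp only [add_assoc, Nat.reduceAdd] at *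
    omega

theorem plusPlus_lt_iff {t : ℕ} : ∀ {c b : ℕ}, (t = 0 → c = 0) →
    (plusPlus c t < b ↔ c < minusMinus b (t + 1)) := by
  have zero_case : ∀ t b : ℕ, (0 < b ↔ 0 < minusMinus b (t + 1)) := by
    intro t b
    rcases Nat.eq_zero_or_pos b with rfl | h0
    · simp
    obtain ⟨l, b, hl, hb, rfl⟩ := exists_choose_add h0 t
    rw [minusMinus_choose_add hl hb]
    have := Nat.choose_pos (show t ≤ l - 1 by omega)
    omega
  induction t with
  | zero =>
    intro c b hc
    obtain rfl := hc rfl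
    simpa using zero_case 0 b
  | succ t ih =>
    intro c b _
    rcases Nat.eq_zero_or_pos c with rfl | hc
    · simpa using zero_case (t + 1) b
    rcases Nat.eq_zero_or_pos b with rfl | hb
    · simp
    obtain ⟨k, c, hk, hck, rfl⟩ := exists_choose_add hc t
    obtain ⟨l, b, hl, hbl, rfl⟩ := exists_choose_add hb (t + 1)
    rw [plusPlus_choose_add hk hck, minusMinus_choose_add hl hbl]
    have e1 := plusPlus_lt (show t ≤ k by omega) hck
    have e2 := minusMinus_le_choose (show t + 1 ≤ l by omega) hbl
    have e3 : (l - 1 + 1).choose (t + 1) = (l - 1).choose t + (l - 1).choose (t + 1) :=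
      Nat.choose_succ_succ' _ _
    have e4 : (k + 1).choose (t + 1) = k.choose t + k.choose (t + 1) := Nat.choose_succ_succ' _ _
    have e5 : (k + 2).choose (t + 2) = (k + 1).choose (t + 1) + (k + 1).choose (t + 2) :=
      Nat.choose_succ_succ' _ _
    have e6 : (l + 1).choose (t + 2) = l.choose (t + 1) + l.choose (t + 2) :=
      Nat.choose_succ_succ' _ _
    rcases lt_trichotomy (k + 1) l with h | h | h
    · have h1 := Nat.choose_le_choose (t + 1) (show k + 1 ≤ l - 1 by omega)
      have h2 := Nat.choose_le_choose (t + 2) (show k + 2 ≤ l by omega)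
      simp only [add_assoc, Nat.reduceAdd] at *
      constructor <;> intro <;> omega
    · subst h
      have := ih (c := c) (b := b) (by rintro rfl; simpa using hck)
      simp only [Nat.add_sub_cancel, add_assoc, Nat.reduceAdd] at *
      omega
    · have h1 := Nat.choose_le_choose (t + 1) (show l - 1 + 1 ≤ k by omega)
      have h2 := Nat.choose_le_choose (t + 2) (show l + 1 ≤ k + 1 by omega)
      simp only [add_assoc, Nat.reduceAdd] at *
      constructor <;> intro <;> omega

theorem le_plusPlus_iff {t c b : ℕ} (ht : 1 ≤ t) :
    b ≤ plusPlus c t ↔ minusMinus b (t + 1) ≤ c := by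
  have := plusPlus_lt_iff (t := t) (c := c) (b := b) (by omega)
  omega

theorem plusPlus_strictMono {t : ℕ} (ht : 1 ≤ t) : StrictMono fun a => plusPlus a t := by
  have key : ∀ t, ∀ a b : ℕ, a < b → (t = 0 → False) → plusPlus a t < plusPlus b t := by
    intro t
    induction t with
    | zero => simp
    | succ t ih =>
      intro a b hab _
      obtain ⟨l, b, hl, hbl, rfl⟩ := exists_choose_add (show 0 < b by omega) t
      have e5 : (l + 1).choose (t + 2) = l.choose (t + 1) + l.choose (t + 2) :=
        Nat.choose_succ_succ' _ _
      have p0 := Nat.choose_pos hl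
      rw [plusPlus_choose_add hl hbl]
      rcases Nat.eq_zero_or_pos a with rfl | ha
      · simp; omega
      obtain ⟨k, c, hk, hck, rfl⟩ := exists_choose_add ha t
      rw [plusPlus_choose_add hk hck]
      have e1 := plusPlus_lt (show t ≤ k by omega) hck
      have e4 : (k + 2).choose (t + 2) = (k + 1).choose (t + 1) + (k + 1).choose (t + 2) :=
        Nat.choose_succ_succ' _ _
      have e6 : (l + 1).choose (t + 1) = l.choose t + l.choose (t + 1) := Nat.choose_succ_succ' _ _
      rcases lt_trichotomy k l with h | rfl | h
      · have h2 := Nat.choose_le_choose (t + 2) (show k + 2 ≤ l + 1 by omega)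
        omega
      · have : t ≠ 0 := by
          rintro rfl
          simp at hbl hck
          omega
        have := ih c b (by omega) this
        omega
      · have h1 := Nat.choose_le_choose (t + 1) (show l + 1 ≤ k by omega)
        omega
  intro a b hab
  exact key t a b hab (by omega)

theorem minusMinus_pos {a t : ℕ} (ha : 0 < a) : 0 < minusMinus a (t + 1) := by
  have := plusPlus_lt_iff (t := t) (c := 0) (b := a) (by simp)
  simpa using this.1 (by simpa using ha)

theorem minusMinus_one_le (a : ℕ) : minusMinus a 1 ≤ 1 := by
  rcases Nat.eq_zero_or_pos a with rfl | h0
  · simp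
  obtain ⟨l, b, hl, hb, rfl⟩ := exists_choose_add h0 0
  rw [minusMinus_choose_add hl hb]
  simp

theorem minusMinus_succ_cases (a t : ℕ) : minusMinus (a + 1) t = minusMinus a t ∨
    minusMinus (a + 1) t = minusMinus a t + 1 := by
  obtain _ | _ | t := t
  · simp
  · simp only [zero_add]
    have h1 := minusMinus_one_le (a + 1)
    have h2 := minusMinus_one_le a
    have h3 : 0 < minusMinus (a + 1) 1 := minusMinus_pos (by omega)
    omega
  · have g := fun c b => plusPlus_lt_iff (t := t + 1) (c := c) (b := b) (by simp)
    have h1 := g (minusMinus a (t + 2)) a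
    have h2 := g (minusMinus (a + 1) (t + 2)) (a + 1)
    have h3 := g (minusMinus a (t + 2) + 1) (a + 1)
    have h4 := plusPlus_strictMono (show 1 ≤ t + 1 by omega)
      (Nat.lt_succ_self (minusMinus a (t + 2)))
    have h5 := g (minusMinus (a + 1) (t + 2)) a
    simp only [Nat.succ_eq_add_one, add_assoc, Nat.reduceAdd] at *
    omega

theorem minusMinus_mono (t : ℕ) : Monotone fun a => minusMinus a t :=
  monotone_nat_of_le_succ fun a => by rcases minusMinus_succ_cases a t with h | h <;> omega

theorem minusMinus_le (a t : ℕ) : minusMinus a t ≤ a := by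
  induction a with
  | zero => simp
  | succ a ih => rcases minusMinus_succ_cases a t with h | h <;> omega

theorem sub_minusMinus_mono (t : ℕ) : Monotone fun a => a - minusMinus a t :=
  monotone_nat_of_le_succ fun a => by rcases minusMinus_succ_cases a t with h | h <;> omega

theorem minusMinus_choose {k t : ℕ} (hk : t + 1 ≤ k) :
    minusMinus (k.choose (t + 1)) (t + 1) = (k - 1).choose t := by
  simpa using minusMinus_choose_add (b := 0) hk (Nat.choose_pos (by omega))

theorem plusPlus_choose {k t : ℕ} (hk : t + 1 ≤ k) :
    plusPlus (k.choose (t + 1)) (t + 1) = (k + 1).choose (t + 2) := by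
  simpa using plusPlus_choose_add (b := 0) hk (Nat.choose_pos (by omega))

theorem small_expansion {t : ℕ} : ∀ {a : ℕ}, a ≤ t → minusMinus a t = a ∧ plusPlus a t = a := by
  induction t with
  | zero => intro a ha; obtain rfl : a = 0 := by omega
            simp
  | succ t ih =>
    intro a ha
    obtain _ | a := a
    · simp
    obtain ⟨h1, h2⟩ := ih (show a ≤ t by omega)
    have hb : a < (t + 1).choose t := by simp; omega
    have h3 := minusMinus_choose_add le_rfl hb
    have h4 := plusPlus_choose_add le_rfl hb
    simp only [Nat.choose_self, Nat.add_sub_cancel, h1, h2] at h3 h4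
    rw [add_comm a 1]
    exact ⟨h3, h4⟩

theorem sub_minusMinus_lt {t : ℕ} : ∀ {a k : ℕ}, t + 1 ≤ k → a < k.choose t →
    a - minusMinus a t < (k - 1).choose t := by
  induction t with
  | zero => intro a k hk ha; simpa using ha
  | succ t ih =>
    intro a k hk ha
    rcases Nat.eq_zero_or_pos a with rfl | h0
    · simpa using Nat.choose_pos (by omega)
    obtain ⟨l, b, hl, hb, rfl⟩ := exists_choose_add h0 t
    rw [minusMinus_choose_add hl hb]
    have hlk : l < k := by
      by_contra! h
      have := Nat.choose_le_choose (t + 1) h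
      omega
    have h1 := ih hl hb
    have h2 := Nat.choose_le_choose (t + 1) (show l ≤ k - 1 by omega)
    obtain ⟨l, rfl⟩ : ∃ l', l = l' + 1 := ⟨l - 1, by omega⟩
    have h3 : (l + 1).choose (t + 1) = l.choose t + l.choose (t + 1) := Nat.choose_succ_succ' _ _
    have h4 := minusMinus_le b t
    simp only [Nat.add_sub_cancel] at *
    omega

theorem plusPlus_sub_minusMinus {t : ℕ} : ∀ a : ℕ, (t = 0 → a = 0) →
    plusPlus (a - minusMinus a t) t + a = plusPlus a t := by
  induction t with
  | zero => intro a ha; simp [ha rfl]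
  | succ t ih =>
    intro a _
    rcases Nat.eq_zero_or_pos a with rfl | h0
    · simp
    obtain ⟨l, b, hl, hb, rfl⟩ := exists_choose_add h0 t
    rcases eq_or_lt_of_le hl with rfl | hl'
    · have : (t + 1).choose (t + 1) + b ≤ t + 1 := by simp at hb ⊢; omega
      obtain ⟨h1, h2⟩ := small_expansion this
      rw [h1, h2]
      simp
    rw [minusMinus_choose_add hl hb, plusPlus_choose_add hl hb]
    have h1 := sub_minusMinus_lt hl hb
    have h2 := ih b (by rintro rfl; simpa using hb)
    have h4 := minusMinus_le b t
    obtain ⟨l, rfl⟩ : ∃ l', l = l' + 1 := ⟨l - 1, by omega⟩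
    have h3 : (l + 1).choose (t + 1) = l.choose t + l.choose (t + 1) := Nat.choose_succ_succ' _ _
    have h5 : (l + 2).choose (t + 2) = (l + 1).choose (t + 1) + (l + 1).choose (t + 2) :=
      Nat.choose_succ_succ' _ _
    simp only [Nat.add_sub_cancel] at *
    have h6 : (l + 1).choose (t + 1) + b - (l.choose t + minusMinus b t) =
      l.choose (t + 1) + (b - minusMinus b t) := by omega
    rw [h6, plusPlus_choose_add (by omega) h1]
    simp only [add_assoc, Nat.reduceAdd] at *
    omega

theorem minusMinus_sub_le (c t : ℕ) :
    minusMinus (c - minusMinus c (t + 1)) (t + 1) ≤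
      minusMinus c (t + 1) - minusMinus (minusMinus c (t + 1)) t := by
  obtain _ | t := t
  · have h1 := minusMinus_one_le (c - minusMinus c 1)
    rcases Nat.eq_zero_or_pos c with rfl | h0
    · simp
    have h3 : 0 < minusMinus c 1 := minusMinus_pos h0
    simp
    omega
  have h1 := plusPlus_sub_minusMinus (t := t + 1) (minusMinus c (t + 2)) (by simp)
  have h2 := (le_plusPlus_iff (t := t + 1) (b := c) (c := minusMinus c (t + 2)) (by omega)).2 le_rfl
  rw [← le_plusPlus_iff (by omega)]
  simp only [add_assoc, Nat.reduceAdd] at *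
  omega

theorem minusMinus_add_le {a b t : ℕ} (h : minusMinus b (t + 1) ≤ a - minusMinus a t)
    (ha : t = 0 → a ≤ 1) :
    minusMinus (a + b) (t + 1) ≤ a := by
  obtain _ | t := t
  · have h1 := minusMinus_one_le (a + b)
    rcases Nat.eq_zero_or_pos a with rfl | h0
    · simpa using h
    · simp only [zero_add]
      omega
  have h1 := plusPlus_sub_minusMinus (t := t + 1) a (by simp)
  rw [← le_plusPlus_iff (by omega)] at h ⊢
  omega

/-- Prepend an exponent to an exponent vector. -/
def consE {n : ℕ} (c : ℕ) (μ : Fin n → ℕ) : Fin (n + 1) → ℕ := Fin.cons c μ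

theorem consE_surj {n : ℕ} (ν : Fin (n + 1) → ℕ) : ∃ c μ, ν = consE c μ :=
  ⟨ν 0, Fin.tail ν, (Fin.cons_self_tail ν).symm⟩

@[simp] theorem consE_inj {n : ℕ} {c d : ℕ} {μ ν : Fin n → ℕ} :
    consE c μ = consE d ν ↔ c = d ∧ μ = ν := Fin.cons_inj

@[simp] theorem consE_zero {n : ℕ} (c : ℕ) (μ : Fin n → ℕ) : consE c μ 0 = c := rfl

@[simp] theorem tail_consE {n : ℕ} (c : ℕ) (μ : Fin n → ℕ) : Fin.tail (consE c μ) = μ := rfl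

@[simp] theorem sum_consE {n : ℕ} (c : ℕ) (μ : Fin n → ℕ) : ∑ i, consE c μ i = c + ∑ i, μ i := by
  rw [Fin.sum_univ_succ]
  rfl

@[simp] theorem consE_add_zero {n : ℕ} (c : ℕ) (μ : Fin n → ℕ) :
    consE c μ + Pi.single 0 1 = consE (c + 1) μ := by
  ext i
  refine Fin.cases ?_ (fun i => ?_) i
  · simp
  · simp [consE]

@[simp] theorem consE_add_succ {n : ℕ} (c : ℕ) (μ : Fin n → ℕ) (i : Fin n) :
    consE c μ + Pi.single i.succ 1 = consE c (μ + Pi.single i 1) := by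
  ext k
  refine Fin.cases ?_ (fun k => ?_) k
  · simp [(Fin.succ_ne_zero i).symm]
  · simp [consE, Pi.single_apply]

@[simp] theorem sum_add_single {n : ℕ} (μ : Fin n → ℕ) (i : Fin n) :
    ∑ k, (μ + Pi.single i 1 : Fin n → ℕ) k = ∑ k, μ k + 1 := by
  simp [Finset.sum_add_distrib]

theorem exists_one_le_of_sum_pos {n : ℕ} {μ : Fin n → ℕ} (h : 0 < ∑ i, μ i) : ∃ i, 1 ≤ μ i := by
  by_contra! hc
  have := Finset.sum_eq_zero (s := Finset.univ) fun i _ => Nat.lt_one_iff.1 (hc i)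
  omega

theorem exists_eq_add_single {n : ℕ} {μ : Fin n → ℕ} {i : Fin n} (h : 1 ≤ μ i) :
    ∃ ν : Fin n → ℕ, μ = ν + Pi.single i 1 := by
  refine ⟨μ - Pi.single i 1, ?_⟩
  ext k
  rcases eq_or_ne k i with rfl | hk
  · simp; omega
  · simp [hk]

/-- The set of monomials outside a strongly stable ideal. -/
structure StableCompl {n : ℕ} (N : Set (Fin n → ℕ)) : Prop where
  down : ∀ (μ : Fin n → ℕ) (i : Fin n), μ + Pi.single i 1 ∈ N → μ ∈ N
  borel : ∀ (μ : Fin n → ℕ) (i j : Fin n), j ≤ i → μ + Pi.single i 1 ∈ N → μ + Pi.single j 1 ∈ N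

/-- The ideal complementary to `N` is generated in degrees at most `m`. -/
def GenLE {n : ℕ} (m : ℕ) (N : Set (Fin n → ℕ)) : Prop :=
  ∀ μ, m < ∑ i, μ i → (∀ (ν : Fin n → ℕ) (i : Fin n), μ = ν + Pi.single i 1 → ν ∈ N) → μ ∈ N

/-- The number of monomials of degree `t` in `N`. -/
noncomputable def hcount {n : ℕ} (N : Set (Fin n → ℕ)) (t : ℕ) : ℕ :=
  Set.ncard {μ | ∑ i, μ i = t ∧ μ ∈ N}

theorem finite_degree {n : ℕ} (N : Set (Fin n → ℕ)) (t : ℕ) :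
    {μ : Fin n → ℕ | ∑ i, μ i = t ∧ μ ∈ N}.Finite := by
  apply (Set.finite_Iic (fun _ : Fin n => t)).subset
  rintro μ ⟨h, -⟩ i
  rw [← h]
  exact Finset.single_le_sum (fun _ _ => Nat.zero_le _) (Finset.mem_univ i)

theorem hcount_mono {n : ℕ} {N N' : Set (Fin n → ℕ)} {t : ℕ}
    (h : ∀ μ, ∑ i, μ i = t → μ ∈ N → μ ∈ N') : hcount N t ≤ hcount N' t :=
  Set.ncard_le_ncard (fun _ hμ => ⟨hμ.1, h _ hμ.1 hμ.2⟩) (finite_degree N' t)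

theorem hcount_congr {n : ℕ} {N N' : Set (Fin n → ℕ)} {t : ℕ}
    (h : ∀ μ, ∑ i, μ i = t → (μ ∈ N ↔ μ ∈ N')) : hcount N t = hcount N' t :=
  le_antisymm (hcount_mono fun μ hμ => (h μ hμ).1) (hcount_mono fun μ hμ => (h μ hμ).2)

theorem hcount_zero {n : ℕ} (N : Set (Fin n → ℕ)) : hcount N 0 = if 0 ∈ N then 1 else 0 := by
  have h : ∀ μ : Fin n → ℕ, ∑ i, μ i = 0 ↔ μ = 0 := by
    intro μ
    simp [funext_iff]
  unfold hcount
  simp only [h]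
  split_ifs with h0
  · rw [Set.ncard_eq_one]
    exact ⟨0, by ext μ; constructor <;> simp +contextual [h0]⟩
  · convert Set.ncard_empty (Fin n → ℕ)
    ext μ
    simp
    rintro rfl
    exact h0

theorem hcount_no_vars (N : Set (Fin 0 → ℕ)) (t : ℕ) : hcount N (t + 1) = 0 := by
  unfold hcount
  convert Set.ncard_empty (Fin 0 → ℕ)
  ext μ
  simp

/-- The restriction of `N` to the monomials not involving the smallest variable. -/
def sect {n : ℕ} (N : Set (Fin (n + 1) → ℕ)) : Set (Fin n → ℕ) := {μ | consE 0 μ ∈ N}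

/-- The quotient of `N` by the smallest variable. -/
def colonZ {n : ℕ} (N : Set (Fin (n + 1) → ℕ)) : Set (Fin (n + 1) → ℕ) :=
  {ν | ν + Pi.single 0 1 ∈ N}

/-- The monomials whose dehomogenization lies in `E`. -/
def coneE {n : ℕ} (E : Set (Fin n → ℕ)) : Set (Fin (n + 1) → ℕ) := {ν | Fin.tail ν ∈ E}

/-- The dehomogenization of the saturation of the ideal complementary to `N`. -/
def satSec {n : ℕ} (N : Set (Fin (n + 1) → ℕ)) : Set (Fin n → ℕ) := {μ | ∀ c, consE c μ ∈ N}

@[simp] theorem mem_coneE {n : ℕ} {E : Set (Fin n → ℕ)} {c : ℕ} {μ : Fin n → ℕ} :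
    consE c μ ∈ coneE E ↔ μ ∈ E := Iff.rfl

theorem hcount_sect_zero {n : ℕ} (N : Set (Fin (n + 1) → ℕ)) : hcount N 0 = hcount (sect N) 0 := by
  have : consE 0 (0 : Fin n → ℕ) = 0 := by
    ext i
    refine Fin.cases rfl (fun i => rfl) i
  simp [hcount_zero, sect, this]

theorem hcount_succ {n : ℕ} (N : Set (Fin (n + 1) → ℕ)) (t : ℕ) :
    hcount N (t + 1) = hcount (sect N) (t + 1) + hcount (colonZ N) t := by
  have h : {ν | ∑ i, ν i = t + 1 ∧ ν ∈ N} =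
      (consE 0 '' {μ | ∑ i, μ i = t + 1 ∧ μ ∈ sect N}) ∪
      ((fun ν => ν + Pi.single 0 1) '' {ν | ∑ i, ν i = t ∧ ν ∈ colonZ N}) := by
    ext ν
    constructor
    · rintro ⟨h1, h2⟩
      obtain ⟨c, μ, rfl⟩ := consE_surj ν
      obtain _ | c := c
      · exact Or.inl ⟨μ, ⟨by simpa using h1, h2⟩, rfl⟩
      · refine Or.inr ⟨consE c μ, ⟨?_, ?_⟩, by simp⟩
        · simp at h1 ⊢
          omega
        · simpa [colonZ] using h2
    · rintro (⟨μ, ⟨h1, h2⟩, rfl⟩ | ⟨ν, ⟨h1, h2⟩, rfl⟩)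
      · exact ⟨by simpa using h1, h2⟩
      · exact ⟨by simp only [sum_add_single, h1], h2⟩
  unfold hcount
  rw [h, Set.ncard_union_eq _ ((finite_degree _ _).image _) ((finite_degree _ _).image _),
    Set.ncard_image_of_injective, Set.ncard_image_of_injective]
  · exact add_left_injective _
  · intro a b hab
    simpa using hab
  · rw [Set.disjoint_left]
    rintro _ ⟨μ, -, rfl⟩ ⟨ν, -, h⟩
    have := congrFun h 0
    simp at this

theorem hcount_coneE_succ {n : ℕ} (E : Set (Fin n → ℕ)) (t : ℕ) :
    hcount (coneE E) (t + 1) = hcount E (t + 1) + hcount (coneE E) t := by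
  rw [hcount_succ]
  rfl

theorem hcount_coneE_zero {n : ℕ} (E : Set (Fin n → ℕ)) : hcount (coneE E) 0 = hcount E 0 :=
  hcount_sect_zero _

namespace StableCompl

variable {n : ℕ} {N : Set (Fin (n + 1) → ℕ)}

theorem sect (h : StableCompl N) : StableCompl (sect N) where
  down μ i hμ := h.down _ i.succ (by simpa [_root_.sect] using hμ)
  borel μ i j hij hμ := by
    simpa [_root_.sect] using h.borel (consE 0 μ) i.succ j.succ (by simpa using hij)
      (by simpa [_root_.sect] using hμ)

theorem colonZ (h : StableCompl N) : StableCompl (colonZ N) where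
  down μ i hμ := by
    refine h.down _ i ?_
    rw [add_right_comm]
    exact hμ
  borel μ i j hij hμ := by
    have := h.borel (μ + Pi.single 0 1) i j hij (by rw [add_right_comm]; exact hμ)
    rw [add_right_comm] at this
    exact this

theorem satSec (h : StableCompl N) : StableCompl (satSec N) where
  down μ i hμ c := h.down _ i.succ (by simpa using hμ c)
  borel μ i j hij hμ c := by
    simpa using h.borel (consE c μ) i.succ j.succ (by simpa using hij) (by simpa using hμ c)

theorem coneE {E : Set (Fin n → ℕ)} (h : StableCompl E) : StableCompl (coneE E) where
  down ν i hν := by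
    obtain ⟨c, μ, rfl⟩ := consE_surj ν
    induction i using Fin.cases with
    | zero => simpa using hν
    | succ i => exact h.down μ i (by simpa using hν)
  borel ν i j hij hν := by
    obtain ⟨c, μ, rfl⟩ := consE_surj ν
    induction i using Fin.cases with
    | zero =>
      obtain rfl : j = 0 := by simpa using hij
      exact hν
    | succ i =>
      simp only [consE_add_succ, mem_coneE] at hν
      induction j using Fin.cases with
      | zero => simpa using h.down μ i hν
      | succ j => simpa using h.borel μ i j (by simpa using hij) hν

/-- Green's bound for the restriction to the smallest variable. -/
theorem minusMinus_hcount_le_colonZ : ∀ {n : ℕ} {N : Set (Fin (n + 1) → ℕ)} (_ : StableCompl N)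
    (t : ℕ), minusMinus (hcount N (t + 1)) (t + 1) ≤ hcount (_root_.colonZ N) t := by
  intro n
  induction n with
  | zero =>
    intro N h t
    rw [hcount_succ, hcount_no_vars, zero_add]
    exact minusMinus_le _ _
  | succ n ih =>
    intro N h t
    induction t generalizing N with
    | zero =>
      have h1 : hcount (_root_.colonZ N) 0 ≤ 1 := by rw [hcount_zero]; split_ifs <;> simp
      rw [hcount_succ, add_comm]
      apply minusMinus_add_le _ fun _ => h1
      simp only [minusMinus_base, Nat.sub_zero]
      refine (ih h.sect 0).trans ?_
      rw [hcount_sect_zero (_root_.colonZ N)]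
      refine hcount_mono fun μ _ hμ => ?_
      exact h.borel _ (Fin.succ 0) 0 (by simp) (by rw [consE_add_succ]; exact hμ)
    | succ t iht =>
      rw [hcount_succ, add_comm]
      apply minusMinus_add_le _ (by simp)
      refine (ih h.sect (t + 1)).trans ?_
      have h1 := iht h.colonZ
      have h2 := hcount_succ (_root_.colonZ N) t
      have h3 : hcount (_root_.colonZ (_root_.sect N)) (t + 1) ≤
          hcount (_root_.sect (_root_.colonZ N)) (t + 1) := by
        refine hcount_mono fun μ _ hμ => ?_
        exact h.borel _ (Fin.succ 0) 0 (by simp) (by rw [consE_add_succ]; exact hμ)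
      omega

end StableCompl

/-- Macaulay's bound. -/
theorem StableCompl.minusMinus_hcount_le {n : ℕ} {N : Set (Fin n → ℕ)} (h : StableCompl N) (t : ℕ) :
    minusMinus (hcount N (t + 1)) (t + 1) ≤ hcount N t := by
  obtain _ | n := n
  · simp [hcount_no_vars]
  · exact (h.minusMinus_hcount_le_colonZ t).trans (hcount_mono fun μ _ hμ => h.down μ 0 hμ)

theorem GenLE.add_single_zero {n m : ℕ} {N : Set (Fin (n + 1) → ℕ)} (hg : GenLE m N)
    (h : StableCompl N) {ν : Fin (n + 1) → ℕ} (hν : ν ∈ N) (hm : m ≤ ∑ i, ν i) :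
    ν + Pi.single 0 1 ∈ N := by
  apply hg _ (by rw [sum_add_single]; omega)
  intro κ i hκ
  rcases eq_or_ne i 0 with rfl | hi
  · rwa [← add_right_cancel hκ]
  · have h1 : 1 ≤ ν i := by
      have := congrFun hκ i
      simp [hi] at this
      omega
    obtain ⟨ξ, rfl⟩ := exists_eq_add_single h1
    rw [add_right_comm] at hκ
    rw [← add_right_cancel hκ]
    exact h.borel _ i 0 (Fin.zero_le _) hν

theorem GenLE.consE {n m : ℕ} {N : Set (Fin (n + 1) → ℕ)} (hg : GenLE m N)
    (h : StableCompl N) {μ : Fin n → ℕ} (hμ : μ ∈ sect N) (hm : m ≤ ∑ i, μ i) : μ ∈ satSec N := by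
  intro c
  induction c with
  | zero => exact hμ
  | succ c ih =>
    rw [← consE_add_zero]
    apply hg.add_single_zero h ih
    rw [sum_consE]
    omega

theorem GenLE.satSec {n m : ℕ} {N : Set (Fin (n + 1) → ℕ)} (hg : GenLE m N)
    (h : StableCompl N) : GenLE m (satSec N) := by
  intro μ hm hμ
  refine hg.consE h ?_ hm.le
  refine hg _ (by simpa using hm) ?_
  intro ν i hν
  obtain ⟨c, ξ, rfl⟩ := consE_surj ν
  induction i using Fin.cases with
  | zero => simp at hν
  | succ i =>
    simp only [consE_add_succ, consE_inj] at hν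
    obtain ⟨rfl, hν⟩ := hν
    exact hμ ξ i hν 0

theorem GenLE.coneE {n m : ℕ} {E : Set (Fin n → ℕ)} (hg : GenLE m E) : GenLE m (coneE E) := by
  intro ν hm hν
  obtain ⟨c, μ, rfl⟩ := consE_surj ν
  obtain _ | c := c
  · refine hg μ (by simpa using hm) fun ξ i hξ => ?_
    exact hν (_root_.consE 0 ξ) i.succ (by simp [hξ])
  · exact hν (_root_.consE c μ) 0 (by simp)

theorem coneE_satSec_subset {n : ℕ} {N : Set (Fin (n + 1) → ℕ)} : coneE (satSec N) ⊆ N := by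
  intro ν hν
  obtain ⟨c, μ, rfl⟩ := consE_surj ν
  exact hν c

theorem GenLE.mono {n m m' : ℕ} {N : Set (Fin n → ℕ)} (hg : GenLE m N) (h : m ≤ m') :
    GenLE m' N := fun μ hμ => hg μ (by omega)

/-- The auxiliary recursion, on the exponent of the smallest variable, defining `lexCo`. -/
noncomputable def lexAux {n : ℕ} (F : ℕ → ℕ → Set (Fin n → ℕ)) : ℕ → ℕ → ℕ → Set (Fin n → ℕ)
  | 0, s, a => F s (a - minusMinus a s)
  | _ + 1, 0, _ => ∅
  | c + 1, s + 1, a => lexAux F c s (minusMinus a (s + 1))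

/-- The complement of a lex-segment in degree `s`: the `a` smallest monomials of degree `s`. -/
noncomputable def lexCo : (n : ℕ) → ℕ → ℕ → Set (Fin n → ℕ)
  | 0, s, a => {_μ | s = 0 ∧ 0 < a}
  | n + 1, s, a => {ν | Fin.tail ν ∈ lexAux (lexCo n) (ν 0) s a}

@[simp] theorem consE_mem_lexCo {n s a c : ℕ} {μ : Fin n → ℕ} :
    consE c μ ∈ lexCo (n + 1) s a ↔ μ ∈ lexAux (lexCo n) c s a := Iff.rfl

theorem sum_of_mem_lexAux {n : ℕ} {F : ℕ → ℕ → Set (Fin n → ℕ)}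
    (hF : ∀ s a, ∀ μ ∈ F s a, ∑ i, μ i = s) {c s a : ℕ} {μ : Fin n → ℕ}
    (h : μ ∈ lexAux F c s a) : c + ∑ i, μ i = s := by
  induction c generalizing s a with
  | zero => simpa using hF _ _ _ h
  | succ c ih =>
    obtain _ | s := s
    · exact h.elim
    · have := ih h
      omega

theorem sum_of_mem_lexCo {n s a : ℕ} {μ : Fin n → ℕ} (h : μ ∈ lexCo n s a) : ∑ i, μ i = s := by
  induction n generalizing s a with
  | zero => simpa using h.1.symm
  | succ n ih =>
    obtain ⟨c, μ, rfl⟩ := consE_surj μ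
    rw [sum_consE]
    exact sum_of_mem_lexAux (fun _ _ _ => ih) h

theorem lexAux_mono {n : ℕ} {F : ℕ → ℕ → Set (Fin n → ℕ)} (hF : ∀ s, Monotone (F s)) (c s : ℕ) :
    Monotone (lexAux F c s) := by
  intro a b hab
  induction c generalizing s a b with
  | zero => exact hF s (sub_minusMinus_mono s hab)
  | succ c ih =>
    obtain _ | s := s
    · exact le_rfl
    · exact ih s (minusMinus_mono _ hab)

theorem lexCo_mono (n s : ℕ) : Monotone (lexCo n s) := by
  induction n generalizing s with
  | zero => exact fun a b hab μ hμ => ⟨hμ.1, hμ.2.trans_le hab⟩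
  | succ n ih => exact fun a b hab μ hμ => lexAux_mono ih _ _ hab hμ

theorem lexCo_borel_down (n : ℕ) :
    (∀ (s a : ℕ) (μ : Fin n → ℕ) (i j : Fin n), j ≤ i →
      μ + Pi.single i 1 ∈ lexCo n s a → μ + Pi.single j 1 ∈ lexCo n s a) ∧
    ∀ (s a b : ℕ) (μ : Fin n → ℕ) (i : Fin n), minusMinus b (s + 1) ≤ a →
      μ + Pi.single i 1 ∈ lexCo n (s + 1) b → μ ∈ lexCo n s a := by
  induction n with
  | zero => exact ⟨fun _ _ _ i => i.elim0, fun _ _ _ _ i => i.elim0⟩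
  | succ n ih =>
    obtain ⟨hb, hd⟩ := ih
    have key : ∀ (s a : ℕ) (μ : Fin (n + 1) → ℕ) (i j : Fin (n + 1)), j ≤ i →
        μ + Pi.single i 1 ∈ lexCo (n + 1) s a → μ + Pi.single j 1 ∈ lexCo (n + 1) s a := by
      intro s a ν i j hij hν
      obtain ⟨c, μ, rfl⟩ := consE_surj ν
      induction i using Fin.cases with
      | zero =>
        obtain rfl : j = 0 := by simpa using hij
        exact hν
      | succ i =>
        rw [consE_add_succ, consE_mem_lexCo] at hν
        induction j using Fin.cases with
        | zero =>
          rw [consE_add_zero, consE_mem_lexCo]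
          induction c generalizing s a with
          | zero =>
            obtain _ | s := s
            · have := sum_of_mem_lexCo hν
              rw [sum_add_single] at this
              omega
            · exact hd _ _ _ _ i (minusMinus_sub_le _ _) hν
          | succ c ihc =>
            obtain _ | s := s
            · exact hν.elim
            · exact ihc _ _ hν
        | succ j =>
          rw [consE_add_succ, consE_mem_lexCo]
          induction c generalizing s a with
          | zero => exact hb _ _ _ i j (by simpa using hij) hν
          | succ c ihc =>
            obtain _ | s := s
            · exact hν.elim
            · exact ihc _ _ hν
    refine ⟨key, fun s a b ν i hab hν => ?_⟩
    have h := key _ _ _ i 0 (Fin.zero_le _) hν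
    obtain ⟨c, μ, rfl⟩ := consE_surj ν
    rw [consE_add_zero, consE_mem_lexCo] at h
    exact lexAux_mono (lexCo_mono n) c s hab h

theorem lexCo_borel {n s a : ℕ} {μ : Fin n → ℕ} {i j : Fin n} (hij : j ≤ i)
    (h : μ + Pi.single i 1 ∈ lexCo n s a) : μ + Pi.single j 1 ∈ lexCo n s a :=
  (lexCo_borel_down n).1 s a μ i j hij h

theorem lexCo_down {n s a b : ℕ} {μ : Fin n → ℕ} {i : Fin n} (hab : minusMinus b (s + 1) ≤ a)
    (h : μ + Pi.single i 1 ∈ lexCo n (s + 1) b) : μ ∈ lexCo n s a :=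
  (lexCo_borel_down n).2 s a b μ i hab h

theorem hcount_lexCo {n s a : ℕ} (ha : a ≤ n.multichoose s) : hcount (lexCo n s a) s = a := by
  induction n generalizing s a with
  | zero =>
    obtain _ | s := s
    · rw [hcount_zero]
      simp only [Nat.multichoose_zero_right] at ha
      simp only [lexCo, Set.mem_ofPred_eq, true_and]
      split_ifs <;> omega
    · rw [hcount_no_vars]
      simp only [Nat.multichoose_zero_succ] at ha
      omega
  | succ n ih =>
    induction s generalizing a with
    | zero =>
      rw [hcount_sect_zero]
      exact ih (by simpa using ha)
    | succ s ihs =>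
      have h1 : n + 1 + (s + 1) - 1 = n + 1 + s := by omega
      have h2 := minusMinus_choose (show s + 1 ≤ n + 1 + s by omega)
      have h3 := minusMinus_mono (s + 1) ha
      have h4 := sub_minusMinus_mono (s + 1) ha
      have h5 := minusMinus_le a (s + 1)
      have h6 := Nat.multichoose_succ_succ n s
      have h7 : minusMinus ((n + 1).multichoose (s + 1)) (s + 1) = (n + 1).multichoose s := by
        rw [Nat.multichoose_eq, Nat.multichoose_eq, h1, h2]
      simp only [h7] at h3 h4
      have h8 : hcount (sect (lexCo (n + 1) (s + 1) a)) (s + 1) = a - minusMinus a (s + 1) :=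
        ih (by omega)
      have h9 : colonZ (lexCo (n + 1) (s + 1) a) = lexCo (n + 1) s (minusMinus a (s + 1)) := by
        ext ν
        obtain ⟨c, μ, rfl⟩ := consE_surj ν
        change _ + _ ∈ lexCo _ _ _ ↔ _
        rw [consE_add_zero]
        rfl
      rw [hcount_succ, h8, h9, ihs h3]
      omega

/-- The cone over lex-segment complements of sizes given by the first difference of `F` consists
of lex-segment complements of sizes `F`. -/
theorem consE_mem_lexCo_iff {n S : ℕ} {F w : ℕ → ℕ} (h0 : w 0 = F 0)
    (hF : ∀ s, s < S → minusMinus (F (s + 1)) (s + 1) = F s)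
    (hw : ∀ s, s < S → F (s + 1) = F s + w (s + 1)) {s c : ℕ} (hs : s ≤ S) {μ : Fin n → ℕ} :
    consE c μ ∈ lexCo (n + 1) s (F s) ↔ c ≤ s ∧ μ ∈ lexCo n (s - c) (w (s - c)) := by
  rw [consE_mem_lexCo]
  induction c generalizing s with
  | zero =>
    simp only [lexAux, Nat.zero_le, Nat.sub_zero, true_and]
    obtain _ | s := s
    · simp [h0]
    · rw [hF s hs, hw s hs]
      simp
  | succ c ih =>
    obtain _ | s := s
    · simp [lexAux]
    · rw [lexAux, hF s hs, ih (by omega)]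
      simp

theorem zchoose_natCast (a k : ℕ) : zchoose a k = a.choose k := by
  simp [zchoose]

theorem zchoose_zero_right (a : ℤ) : zchoose a 0 = 1 := by
  simp [zchoose]

theorem zchoose_sub (a : ℤ) (k : ℕ) :
    zchoose a (k + 1) - zchoose (a - 1) (k + 1) = zchoose (a - 1) k := by
  rcases lt_trichotomy a 0 with h | rfl | h
  · obtain ⟨b, rfl⟩ : ∃ b : ℕ, a = -(b : ℤ) - 1 := ⟨(-a - 1).toNat, by omega⟩
    simp only [zchoose]
    rw [if_neg (by omega), if_neg (by omega), if_neg (by omega)]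
    have h1 : (((k + 1 : ℕ) : ℤ) - 1 - (-(b : ℤ) - 1)).toNat = k + b + 1 := by omega
    have h2 : (((k + 1 : ℕ) : ℤ) - 1 - (-(b : ℤ) - 1 - 1)).toNat = k + b + 1 + 1 := by omega
    have h3 : ((k : ℤ) - 1 - (-(b : ℤ) - 1 - 1)).toNat = k + b + 1 := by omega
    rw [h1, h2, h3, Nat.choose_succ_succ' (k + b + 1) k]
    push_cast
    ring
  · simp only [zchoose]
    rw [if_pos (by omega), if_neg (by omega), if_neg (by omega)]
    have h2 : (((k + 1 : ℕ) : ℤ) - 1 - (0 - 1)).toNat = k + 1 := by omega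
    have h3 : ((k : ℤ) - 1 - (0 - 1)).toNat = k := by omega
    rw [h2, h3]
    simp
    ring
  · obtain ⟨b, rfl⟩ : ∃ b : ℕ, a = (b + 1 : ℕ) := ⟨(a - 1).toNat, by omega⟩
    have : ((b + 1 : ℕ) : ℤ) - 1 = (b : ℕ) := by push_cast; ring
    rw [this, zchoose_natCast, zchoose_natCast, zchoose_natCast, Nat.choose_succ_succ']
    push_cast
    ring

/-- The value at `z` of the polynomial with Gotzmann coefficients `ks`. -/
def gotz : List ℕ → ℤ → ℤ
  | [], _ => 0
  | k :: ks, z => zchoose (z + k) k + gotz ks (z - 1)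

theorem sum_zchoose_eq_gotz (ks : List ℕ) (z : ℤ) :
    ∑ i ∈ Finset.range ks.length, zchoose (z + (ks.getD i 0 : ℤ) - i) (ks.getD i 0) = gotz ks z := by
  induction ks generalizing z with
  | nil => simp [gotz]
  | cons k ks ih =>
    rw [List.length_cons, Finset.sum_range_succ', gotz, ← ih, add_comm]
    congr 1
    · simp
    · refine Finset.sum_congr rfl fun i _ => ?_
      rw [List.getD_cons_succ]
      congr 1
      push_cast
      ring

theorem gotz_replicate (c : ℕ) (z : ℤ) : gotz (List.replicate c 0) z = c := by
  induction c generalizing z with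
  | zero => simp [gotz]
  | succ c ih =>
    rw [List.replicate_succ, gotz, ih, zchoose_zero_right]
    push_cast
    ring

theorem eq_replicate_of_cons_zero {ks : List ℕ} (h : (0 :: ks).Pairwise (· ≥ ·)) :
    ks = List.replicate ks.length 0 := by
  rw [List.eq_replicate_iff]
  refine ⟨rfl, fun b hb => ?_⟩
  have := (List.pairwise_cons.1 h).1 b hb
  omega

theorem gotz_delta {ks : List ℕ} (h : ks.Pairwise (· ≥ ·)) (z : ℤ) :
    gotz ((ks.filter fun k => 1 ≤ k).map fun k => k - 1) z = gotz ks z - gotz ks (z - 1) := by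
  induction ks generalizing z with
  | nil => simp [gotz]
  | cons k ks ih =>
    obtain _ | k := k
    · have e := eq_replicate_of_cons_zero h
      rw [e]
      simp [gotz, gotz_replicate, zchoose_zero_right]
    · have h1 := zchoose_sub (z + (k + 1 : ℕ)) k
      have h2 : z + ((k + 1 : ℕ) : ℤ) - 1 = z + k := by push_cast; ring
      have h3 : z - 1 + ((k + 1 : ℕ) : ℤ) = z + k := by push_cast; ring
      rw [h2] at h1
      have h4 := ih (List.pairwise_cons.1 h).2 (z - 1)
      simp only [List.filter_cons, Nat.le_add_left, decide_true, if_true, List.map_cons, gotz,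
        Nat.add_sub_cancel]
      rw [h3]
      linarith

theorem gotz_pos {ks : List ℕ} (h : ks ≠ []) {t : ℕ} (ht : ks.length ≤ t + 1) :
    0 < gotz ks t := by
  have key : ∀ (ks : List ℕ) (t : ℕ), ks.length ≤ t → 0 ≤ gotz ks ((t : ℤ) - 1) := by
    intro ks
    induction ks with
    | nil => simp [gotz]
    | cons k ks ih =>
      intro t ht
      obtain _ | t := t
      · simp at ht
      have e : ((t + 1 : ℕ) : ℤ) - 1 = (t : ℕ) := by push_cast; ring
      rw [e, gotz]
      have := ih t (by simpa using ht)
      have e2 : (t : ℤ) + k = (t + k : ℕ) := by push_cast; ring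
      rw [e2, zchoose_natCast]
      positivity
  obtain _ | ⟨k, ks⟩ := ks
  · exact absurd rfl h
  have e2 : (t : ℤ) + k = (t + k : ℕ) := by push_cast; ring
  rw [gotz, e2, zchoose_natCast]
  have h1 := key ks t (by simpa using ht)
  have h2 : 0 < (t + k).choose k := Nat.choose_pos (by omega)
  have h3 : (0 : ℤ) < (t + k).choose k := by exact_mod_cast h2
  linarith

theorem gotz_lt {ks : List ℕ} {k t : ℕ} (hk : ∀ l ∈ ks, l ≤ k) (ht : ks.length ≤ t) :
    gotz ks t < (t + 1 + k).choose t := by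
  induction ks generalizing t with
  | nil =>
    have : 0 < (t + 1 + k).choose t := Nat.choose_pos (by omega)
    simpa [gotz] using this
  | cons l ks ih =>
    obtain _ | t := t
    · simp at ht
    have h1 := ih (t := t) (fun l' hl' => hk l' (by simp [hl'])) (by simpa using ht)
    have h2 : ((t + 1 : ℕ) : ℤ) - 1 = (t : ℕ) := by push_cast; ring
    have h3 : ((t + 1 : ℕ) : ℤ) + l = (t + 1 + l : ℕ) := by push_cast; ring
    rw [gotz, h2, h3, zchoose_natCast, ← Nat.choose_symm_add (a := t + 1)]
    have h4 : (t + 1 + l).choose (t + 1) ≤ (t + 1 + k).choose (t + 1) :=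
      Nat.choose_le_choose _ (by have := hk l (by simp); omega)
    have h5 : (t + 1 + 1 + k).choose (t + 1) =
        (t + 1 + k).choose t + (t + 1 + k).choose (t + 1) := by
      rw [show t + 1 + 1 + k = t + 1 + k + 1 by omega, Nat.choose_succ_succ']
    rw [h5]
    push_cast
    have h6 : (((t + 1 + l).choose (t + 1) : ℕ) : ℤ) ≤ (t + 1 + k).choose (t + 1) := by
      exact_mod_cast h4
    linarith

/-- Polynomials in Gotzmann form have maximal growth. -/
theorem gotz_persist {ks : List ℕ} (h : ks.Pairwise (· ≥ ·)) {t : ℕ} (ht : ks.length ≤ t) :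
    ∃ a : ℕ, gotz ks t = a ∧ gotz ks (t + 1) = plusPlus a t := by
  induction ks generalizing t with
  | nil => exact ⟨0, by simp [gotz]⟩
  | cons k ks ih =>
    obtain _ | t := t
    · simp at ht
    rw [List.pairwise_cons] at h
    have ht' : ks.length ≤ t := by simpa using ht
    obtain ⟨a, h1, h2⟩ := ih h.2 ht'
    have h3 : a < (t + 1 + k).choose t := by
      have := gotz_lt (k := k) (fun l hl => h.1 l hl) ht'
      rw [h1] at this
      exact_mod_cast this
    refine ⟨(t + 1 + k).choose (t + 1) + a, ?_, ?_⟩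
    · rw [gotz, show ((t + 1 : ℕ) : ℤ) - 1 = (t : ℕ) by push_cast; ring, h1,
        show ((t + 1 : ℕ) : ℤ) + k = (t + 1 + k : ℕ) by push_cast; ring, zchoose_natCast,
        Nat.choose_symm_add]
      push_cast
      ring
    · rw [plusPlus_choose_add (by omega) h3, gotz,
        show ((t + 1 : ℕ) : ℤ) + 1 - 1 = (t : ℤ) + 1 by push_cast; ring, h2,
        show ((t + 1 : ℕ) : ℤ) + 1 + k = (t + 2 + k : ℕ) by push_cast; ring, zchoose_natCast,
        ← Nat.choose_symm_add (a := t + 2), show t + 1 + k + 1 = t + 2 + k by omega]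
      push_cast
      ring

namespace GotzmannPoly

theorem eval_eq_gotz (p : GotzmannPoly) (z : ℤ) : p.eval z = gotz p.ks z :=
  sum_zchoose_eq_gotz p.ks z

theorem eval_delta (p : GotzmannPoly) (z : ℤ) :
    p.delta.eval z = p.eval z - p.eval (z - 1) := by
  simp only [eval_eq_gotz]
  exact gotz_delta p.sorted z

theorem eval_succ (p : GotzmannPoly) (t : ℕ) :
    p.eval ((t + 1 : ℕ) : ℤ) = p.eval (t : ℤ) + p.delta.eval ((t + 1 : ℕ) : ℤ) := by
  rw [eval_delta]
  push_cast
  rw [add_sub_cancel_right]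
  ring

theorem deltaIter_zero (p : GotzmannPoly) : p.deltaIter 0 = p := rfl

theorem deltaIter_succ (p : GotzmannPoly) (i : ℕ) : p.deltaIter (i + 1) = (p.deltaIter i).delta :=
  Function.iterate_succ_apply' _ _ _

theorem deltaIter_succ' (p : GotzmannPoly) (i : ℕ) :
    p.deltaIter (i + 1) = p.delta.deltaIter i :=
  Function.iterate_succ_apply _ _ _

theorem length_delta_le (p : GotzmannPoly) : p.delta.ks.length ≤ p.ks.length := by
  simp only [delta, List.length_map]
  exact List.length_filter_le _ _

theorem length_deltaIter_le (p : GotzmannPoly) (i : ℕ) :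
    (p.deltaIter i).ks.length ≤ p.ks.length := by
  induction i with
  | zero => exact le_rfl
  | succ i ih =>
    rw [deltaIter_succ]
    exact (length_delta_le _).trans ih

theorem mem_delta {p : GotzmannPoly} {k : ℕ} : k ∈ p.delta.ks ↔ k + 1 ∈ p.ks := by
  simp only [delta, List.mem_map, List.mem_filter, decide_eq_true_eq]
  constructor
  · rintro ⟨a, ⟨h1, h2⟩, rfl⟩
    rwa [Nat.sub_add_cancel h2]
  · exact fun h => ⟨k + 1, ⟨h, by omega⟩, by omega⟩

theorem mem_deltaIter {p : GotzmannPoly} {k i : ℕ} : k ∈ (p.deltaIter i).ks ↔ k + i ∈ p.ks := by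
  induction i generalizing k with
  | zero => rfl
  | succ i ih =>
    rw [deltaIter_succ, mem_delta, ih, add_assoc, add_comm 1 i]

theorem le_degree {p : GotzmannPoly} {k : ℕ} (h : k ∈ p.ks) : k ≤ p.degree := by
  obtain ⟨ks, hs⟩ := p
  obtain _ | ⟨a, ks⟩ := ks
  · simp at h
  rcases List.mem_cons.1 h with rfl | h
  · exact le_rfl
  · exact (List.pairwise_cons.1 hs).1 _ h

theorem degree_mem {p : GotzmannPoly} (h : p.ks ≠ []) : p.degree ∈ p.ks := by
  obtain ⟨ks, hs⟩ := p
  obtain _ | ⟨a, ks⟩ := ks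
  · exact absurd rfl h
  · simp [degree]

theorem deltaIter_ne_nil {p : GotzmannPoly} (h : p.ks ≠ []) {i : ℕ} (hi : i ≤ p.degree) :
    (p.deltaIter i).ks ≠ [] :=
  List.ne_nil_of_mem (a := p.degree - i) (mem_deltaIter.2 (by
    rw [Nat.sub_add_cancel hi]
    exact degree_mem h))

theorem deltaIter_eq_nil {p : GotzmannPoly} {i : ℕ} (hi : p.degree < i) :
    (p.deltaIter i).ks = [] := by
  rw [List.eq_nil_iff_forall_not_mem]
  intro k hk
  have := le_degree (mem_deltaIter.1 hk)
  omega

theorem eval_of_nil {p : GotzmannPoly} (h : p.ks = []) (z : ℤ) : p.eval z = 0 := by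
  rw [eval_eq_gotz, h, gotz]

theorem delta_of_nil {p : GotzmannPoly} (h : p.ks = []) : p.delta.ks = [] := by
  simp [delta, h]

theorem deltaIter_of_nil {p : GotzmannPoly} (h : p.ks = []) (i : ℕ) : (p.deltaIter i).ks = [] := by
  rw [← List.length_eq_zero_iff, ← Nat.le_zero]
  simpa [h] using length_deltaIter_le p i

theorem eval_pos {p : GotzmannPoly} (h : p.ks ≠ []) {t : ℕ} (ht : p.ks.length ≤ t + 1) :
    0 < p.eval t := by
  rw [eval_eq_gotz]
  exact gotz_pos h ht

theorem eval_nonneg (p : GotzmannPoly) {t : ℕ} (ht : p.ks.length ≤ t + 1) : 0 ≤ p.eval t := by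
  by_cases h : p.ks = []
  · rw [eval_of_nil h]
  · exact (eval_pos h ht).le

theorem eq_nil_of_eventually {p : GotzmannPoly} {N : ℕ} (h : ∀ t : ℕ, N ≤ t → p.eval t = 0) :
    p.ks = [] := by
  by_contra hp
  have h1 := eval_pos hp (t := max N p.ks.length) (by omega)
  rw [h _ (by omega)] at h1
  exact lt_irrefl _ h1

theorem plusPlus_eval (p : GotzmannPoly) {t : ℕ} (ht : p.ks.length ≤ t) :
    p.eval ((t + 1 : ℕ) : ℤ) = plusPlus (p.eval t).toNat t := by
  obtain ⟨a, h1, h2⟩ := gotz_persist p.sorted ht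
  rw [eval_eq_gotz, eval_eq_gotz, h1]
  push_cast
  rw [h2]
  simp

theorem minusMinus_eval_le (p : GotzmannPoly) {t : ℕ} (ht : p.ks.length ≤ t) :
    (minusMinus (p.eval ((t + 1 : ℕ) : ℤ)).toNat (t + 1) : ℤ) ≤ p.eval t := by
  have h0 := eval_nonneg p (t := t) (by omega)
  by_cases h : p.ks = []
  · simp [eval_of_nil h]
  · have h1 : 1 ≤ t := (List.length_pos_iff.2 h).trans_le ht
    have h2 := plusPlus_eval p ht
    have h3 := (le_plusPlus_iff h1 (b := (p.eval ((t + 1 : ℕ) : ℤ)).toNat)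
      (c := (p.eval t).toNat)).1 (by omega)
    omega

theorem eq_cons_of_delta {p : GotzmannPoly} {d : ℕ} (h : p.delta.ks = [d]) :
    ∃ c, p.ks = (d + 1) :: List.replicate c 0 := by
  obtain ⟨ks, hs⟩ := p
  obtain _ | ⟨k, ks⟩ := ks
  · simp [delta] at h
  obtain _ | k := k
  · have e := eq_replicate_of_cons_zero hs
    rw [List.eq_replicate_iff] at e
    have h1 : d + 1 ∈ 0 :: ks := mem_delta (p := ⟨0 :: ks, hs⟩).1 (by rw [h]; simp)
    rcases List.mem_cons.1 h1 with h1 | h1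
    · omega
    · have := e.2 _ h1
      omega
  · simp [delta] at h
    obtain ⟨rfl, h⟩ := h
    refine ⟨ks.length, ?_⟩
    change _ :: _ = _
    congr 1
    rw [List.eq_replicate_iff]
    exact ⟨rfl, h⟩

theorem eval_zero_cons {p : GotzmannPoly} {k c : ℕ} (h : p.ks = k :: List.replicate c 0) (t : ℕ) :
    p.eval t = (t + k).choose k + c := by
  rw [eval_eq_gotz, h, gotz, gotz_replicate, ← Nat.cast_add, zchoose_natCast]

theorem eq_singleton_of_eventually {p : GotzmannPoly} {d N : ℕ}
    (h : ∀ t : ℕ, N ≤ t → p.eval t = (t + d).choose d) : p.ks = [d] := by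
  induction d generalizing p N with
  | zero =>
    have h1 : p.delta.ks = [] := by
      apply eq_nil_of_eventually (N := N + 1)
      intro t ht
      obtain _ | t := t
      · omega
      have := eval_succ p t
      rw [h _ (by omega), h _ (by omega)] at this
      simp at this
      exact_mod_cast this
    have h2 : p.ks = List.replicate p.ks.length 0 := by
      rw [List.eq_replicate_iff]
      refine ⟨rfl, fun b hb => ?_⟩
      by_contra hb0
      have : b - 1 ∈ p.delta.ks := mem_delta.2 (by rwa [Nat.sub_add_cancel (by omega)])
      simp [h1] at this
    have h3 := h N le_rfl
    rw [eval_eq_gotz, h2, gotz_replicate] at h3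
    have h4 : p.ks.length = 1 := by simpa using h3
    rw [h2, h4]
    rfl
  | succ d ih =>
    have h1 : p.delta.ks = [d] := by
      apply ih (N := N + 1)
      intro t ht
      obtain _ | t := t
      · omega
      have := eval_succ p t
      rw [h _ (by omega), h _ (by omega)] at this
      have e : (t + 1 + (d + 1)).choose (d + 1) =
          (t + 1 + d).choose d + (t + (d + 1)).choose (d + 1) := by
        rw [← add_assoc, Nat.choose_succ_succ', show t + 1 + d = t + (d + 1) by omega]
      rw [e] at this
      push_cast at this ⊢
      linarith
    obtain ⟨c, hc⟩ := eq_cons_of_delta h1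
    have h2 := h N le_rfl
    rw [eval_zero_cons hc] at h2
    have : c = 0 := by simpa using h2
    rw [hc, this]
    rfl

end GotzmannPoly

theorem fmin_of_le (q : GotzmannPoly) {l t : ℕ} (h : l ≤ t) : fmin q l t = q.eval t := by
  rw [fmin, dif_pos h]

theorem fmin_of_lt (q : GotzmannPoly) {l t : ℕ} (h : t < l) :
    fmin q l t = minusMinus (fmin q l (t + 1)).toNat (t + 1) := by
  rw [fmin, dif_neg (by omega)]

theorem fmin_le {q : GotzmannPoly} {l : ℕ} {w : ℕ → ℤ}
    (hw : ∀ s, s < l → (minusMinus (w (s + 1)).toNat (s + 1) : ℤ) ≤ w s) (h : q.eval l ≤ w l)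
    {s : ℕ} (hs : s ≤ l) : fmin q l s ≤ w s := by
  obtain ⟨j, rfl⟩ := Nat.exists_eq_add_of_le hs
  clear hs
  induction j generalizing s with
  | zero => rwa [fmin_of_le _ (by omega)]
  | succ j ih =>
    rw [fmin_of_lt _ (by omega)]
    refine le_trans ?_ (hw s (by omega))
    have h1 := ih (s := s + 1)
    rw [show s + 1 + j = s + (j + 1) by omega] at h1
    have h2 := minusMinus_mono (s + 1) (Int.toNat_le_toNat (h1 hw h))
    exact_mod_cast h2

theorem OSeq.minusMinus_le {w : ℕ → ℤ} (h : OSeq w) (s : ℕ) :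
    (minusMinus (w (s + 1)).toNat (s + 1) : ℤ) ≤ w s := by
  obtain ⟨h1, h2, h3⟩ := h
  obtain _ | s := s
  · rw [h2]
    exact_mod_cast minusMinus_one_le _
  · have h4 := h3 (s + 1) (by omega)
    have h5 := h1 (s + 1)
    have h6 := (le_plusPlus_iff (show 1 ≤ s + 1 by omega) (b := (w (s + 1 + 1)).toNat)
      (c := (w (s + 1)).toNat)).1 (by omega)
    omega

theorem oSeq_of_minusMinus_le {w : ℕ → ℤ} (h0 : w 0 = 1)
    (h : ∀ s, (minusMinus (w (s + 1)).toNat (s + 1) : ℤ) ≤ w s) : OSeq w := by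
  refine ⟨fun t => (Nat.cast_nonneg _).trans (h t), h0, fun t ht => ?_⟩
  have h1 : (0 : ℤ) ≤ w t := (Nat.cast_nonneg _).trans (h t)
  have h2 := (le_plusPlus_iff ht (b := (w (t + 1)).toNat) (c := (w t).toNat)).2
    (by have := h t; omega)
  omega

theorem exists_isRegOf {p : GotzmannPoly} {H : ℕ → ℤ} {l : ℕ}
    (h : ∀ t : ℕ, l ≤ t → H t = p.eval t) : ∃ ρ ≤ l, IsRegOf p H ρ :=
  have hex : ∃ l, ∀ t : ℕ, l ≤ t → H t = p.eval t := ⟨l, h⟩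
  ⟨Nat.find hex, Nat.find_min' hex h, Nat.find_spec hex, fun _ h' => Nat.find_min' hex h'⟩

theorem StableCompl.down_add {n : ℕ} {N : Set (Fin n → ℕ)} (h : StableCompl N)
    (μ ν : Fin n → ℕ) (hμ : μ + ν ∈ N) : μ ∈ N := by
  induction hd : ∑ i, ν i generalizing ν with
  | zero =>
    have : ν = 0 := by
      ext i
      simpa using (Finset.sum_eq_zero_iff.1 hd) i
    simpa [this] using hμ
  | succ d ih =>
    obtain ⟨i, hi⟩ : ∃ i, 1 ≤ ν i := exists_one_le_of_sum_pos (by omega)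
    obtain ⟨ξ, rfl⟩ := exists_eq_add_single hi
    rw [sum_add_single] at hd
    rw [← add_assoc] at hμ
    exact ih ξ (h.down _ _ hμ) (by omega)

theorem StableCompl.zero_mem {n : ℕ} {N : Set (Fin n → ℕ)} (h : StableCompl N) {μ : Fin n → ℕ}
    (hμ : μ ∈ N) : 0 ∈ N :=
  h.down_add 0 μ (by rwa [zero_add])

theorem StableCompl.hcount_eq_zero {n : ℕ} {N : Set (Fin n → ℕ)} (h : StableCompl N)
    (h0 : 0 ∉ N) (t : ℕ) : hcount N t = 0 := by
  unfold hcount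
  convert Set.ncard_empty (Fin n → ℕ)
  ext μ
  simp only [Set.mem_ofPred_eq, Set.mem_empty_iff_false, iff_false, not_and]
  exact fun _ hμ => h0 (h.zero_mem hμ)

theorem StableCompl.oSeq {n : ℕ} {N : Set (Fin n → ℕ)} (h : StableCompl N) (h0 : 0 ∈ N) :
    OSeq fun t => (hcount N t : ℤ) := by
  refine oSeq_of_minusMinus_le (by simp [hcount_zero, h0]) fun s => ?_
  rw [Int.toNat_natCast]
  exact_mod_cast h.minusMinus_hcount_le s

theorem nderiv_hcount_coneE {n : ℕ} {E : Set (Fin n → ℕ)} (h0 : 0 ∈ E) :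
    (nderiv fun t => (hcount (coneE E) t : ℤ)) = fun t => (hcount E t : ℤ) := by
  ext t
  obtain _ | t := t
  · simp [nderiv, hcount_zero, h0]
  · simp only [nderiv, hcount_coneE_succ]
    push_cast
    ring

/-- The values in degree `l` of a polynomial and its differences grow admissibly from degree
`l - 1` to degree `l`. -/
def PersistAt (q : GotzmannPoly) (l : ℕ) : Prop :=
  ∀ i, 0 ≤ (q.deltaIter i).eval l ∧
    (minusMinus ((q.deltaIter i).eval l).toNat l : ℤ) ≤
      (q.deltaIter i).eval l - (q.deltaIter (i + 1)).eval l

theorem PersistAt.of_nil {q : GotzmannPoly} (h : q.ks = []) (l : ℕ) : PersistAt q l := by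
  intro i
  rw [GotzmannPoly.eval_of_nil (GotzmannPoly.deltaIter_of_nil h _),
    GotzmannPoly.eval_of_nil (GotzmannPoly.deltaIter_of_nil h _)]
  simp

theorem PersistAt.delta {q : GotzmannPoly} {l : ℕ} (h : PersistAt q l) : PersistAt q.delta l := by
  intro i
  rw [← GotzmannPoly.deltaIter_succ', ← GotzmannPoly.deltaIter_succ']
  exact h (i + 1)

theorem persistAt_iff {q : GotzmannPoly} {l : ℕ} : PersistAt q l ↔ (0 ≤ q.eval l ∧
    (minusMinus (q.eval l).toNat l : ℤ) ≤ q.eval l - q.delta.eval l) ∧ PersistAt q.delta l := by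
  refine ⟨fun h => ⟨h 0, h.delta⟩, fun ⟨h1, h2⟩ i => ?_⟩
  obtain _ | i := i
  · exact h1
  · rw [GotzmannPoly.deltaIter_succ', GotzmannPoly.deltaIter_succ']
    exact h2 i

theorem mem_coneE_satSec {n m : ℕ} {N : Set (Fin (n + 1) → ℕ)} (hg : GenLE m N)
    (h : StableCompl N) {ν : Fin (n + 1) → ℕ} (hν : ν ∈ N) (hm : m ≤ ∑ i, ν i) :
    ν ∈ coneE (satSec N) := by
  obtain ⟨c, μ, rfl⟩ := consE_surj ν
  intro c'
  rw [sum_consE] at hm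
  rcases le_total c' c with hc | hc
  · obtain ⟨d, rfl⟩ := Nat.exists_eq_add_of_le hc
    clear hm hc
    induction d with
    | zero => exact hν
    | succ d ih =>
      apply ih
      rw [← add_assoc, ← consE_add_zero] at hν
      exact h.down _ _ hν
  · obtain ⟨d, rfl⟩ := Nat.exists_eq_add_of_le hc
    clear hc
    induction d with
    | zero => exact hν
    | succ d ih =>
      rw [← add_assoc, ← consE_add_zero]
      refine hg.add_single_zero h ih ?_
      rw [tail_consE, sum_consE]
      omega

theorem eq_eval_of_succ {q : GotzmannPoly} {v : ℕ → ℤ} {l N : ℕ}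
    (hN : ∀ t, N ≤ t → v t = q.eval t)
    (h : ∀ t, l ≤ t → v (t + 1) = v t + q.delta.eval ((t + 1 : ℕ) : ℤ)) {t : ℕ} (ht : l ≤ t) :
    v t = q.eval t := by
  have key : ∀ j, v (t + j) - q.eval ((t + j : ℕ) : ℤ) = v t - q.eval t := by
    intro j
    induction j with
    | zero => rfl
    | succ j ih =>
      rw [← ih, ← add_assoc, h _ (by omega), GotzmannPoly.eval_succ q (t + j)]
      ring
  have h1 := key N
  rw [hN _ (by omega)] at h1
  linarith

/-- Consequences of bounded regularity for the Hilbert function and the Hilbert polynomial of the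
quotient by a strongly stable ideal. -/
theorem StableCompl.bounds {n : ℕ} {D : Set (Fin n → ℕ)} (hD : StableCompl D) {l : ℕ} (hl : 1 ≤ l)
    (hg : GenLE (l + 1) D) {q : GotzmannPoly} {N : ℕ}
    (hN : ∀ t, N ≤ t → (hcount D t : ℤ) = q.eval t) :
    (∀ t, l + 1 ≤ t → (hcount D t : ℤ) = q.eval t) ∧ q.eval l ≤ hcount D l ∧ PersistAt q l ∧
    ∀ i, (q.deltaIter i).ks ≠ [] → ∃ ρ ≤ l, (Fset (q.deltaIter i) ρ).Nonempty := by
  induction n generalizing q N with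
  | zero =>
    have hq : q.ks = [] := by
      apply GotzmannPoly.eq_nil_of_eventually (N := N + 1)
      intro t ht
      obtain _ | t := t
      · omega
      rw [← hN _ (by omega), hcount_no_vars]
      rfl
    refine ⟨?_, ?_, PersistAt.of_nil hq l, fun i hi => ?_⟩
    · intro t ht
      obtain _ | t := t
      · omega
      rw [hcount_no_vars, GotzmannPoly.eval_of_nil hq]
      rfl
    · rw [GotzmannPoly.eval_of_nil hq]
      positivity
    · exact absurd (GotzmannPoly.deltaIter_of_nil hq i) hi
  | succ n ih =>
    have hE := hD.satSec
    have hEq : ∀ t, l + 1 ≤ t + 1 → (hcount (_root_.coneE (_root_.satSec D)) (t + 1) : ℤ) =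
        hcount D (t + 1) := by
      intro t ht
      congr 1
      exact hcount_congr fun ν hν =>
        ⟨fun h => coneE_satSec_subset h, fun h => mem_coneE_satSec hg hD h (by omega)⟩
    have hv : ∀ t, (hcount (_root_.coneE (_root_.satSec D)) (t + 1) : ℤ) =
        hcount (_root_.coneE (_root_.satSec D)) t + hcount (_root_.satSec D) (t + 1) := by
      intro t
      rw [hcount_coneE_succ]
      push_cast
      ring
    have hN' : ∀ t, N + l + 2 ≤ t → (hcount (_root_.satSec D) t : ℤ) = q.delta.eval t := by
      intro t ht
      obtain _ | _ | t := t
      · omega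
      · omega
      have h1 := hv (t + 1)
      rw [hEq _ (by omega), hEq _ (by omega), hN _ (by omega), hN _ (by omega),
        GotzmannPoly.eval_succ] at h1
      linarith
    obtain ⟨i1, i2, i3, i4⟩ := ih hE (hg.satSec hD) hN'
    have hvq : ∀ t, l ≤ t → (hcount (_root_.coneE (_root_.satSec D)) t : ℤ) = q.eval t := by
      intro t ht
      refine eq_eval_of_succ (v := fun t => (hcount (_root_.coneE (_root_.satSec D)) t : ℤ))
        (N := N + l + 1) (l := l) ?_ ?_ ht
      · intro t ht
        obtain _ | t := t
        · omega
        · rw [hEq _ (by omega), hN _ (by omega)]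
      · intro t ht
        rw [hv, i1 _ (by omega)]
    refine ⟨fun t ht => ?_, ?_, ?_, fun i hi => ?_⟩
    · obtain _ | t := t
      · omega
      · rw [← hEq _ ht, hvq _ (by omega)]
    · rw [← hvq l le_rfl]
      exact_mod_cast hcount_mono fun ν _ h => coneE_satSec_subset h
    · rw [persistAt_iff]
      refine ⟨⟨?_, ?_⟩, i3⟩
      · rw [← hvq l le_rfl]
        positivity
      · obtain _ | l := l
        · omega
        have h1 := hE.coneE.minusMinus_hcount_le l
        have h2 := hv l
        rw [← hvq _ le_rfl, Int.toNat_natCast]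
        omega
    · obtain _ | i := i
      · have h0 : 0 ∈ _root_.satSec D := by
          by_contra h0
          apply hi
          apply GotzmannPoly.eq_nil_of_eventually (N := l)
          intro t ht
          rw [GotzmannPoly.deltaIter_zero, ← hvq t ht, hE.coneE.hcount_eq_zero h0]
          rfl
        obtain ⟨ρ, h1, h2⟩ := exists_isRegOf (p := q.deltaIter 0) hvq
        refine ⟨ρ, h1, _, hE.coneE.oSeq h0, ?_, h2⟩
        rw [nderiv_hcount_coneE h0]
        exact hE.oSeq h0
      · rw [GotzmannPoly.deltaIter_succ'] at hi ⊢
        exact i4 i hi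

theorem StableCompl.fmin_le {n : ℕ} {D : Set (Fin n → ℕ)} (hD : StableCompl D) {l : ℕ} (hl : 1 ≤ l)
    (hg : GenLE (l + 1) D) {q : GotzmannPoly} {N : ℕ}
    (hN : ∀ t, N ≤ t → (hcount D t : ℤ) = q.eval t) (s : ℕ) : fmin q l s ≤ hcount D s := by
  obtain ⟨h1, h2, -, -⟩ := hD.bounds hl hg hN
  rcases le_total s l with hs | hs
  · refine _root_.fmin_le (w := fun s => (hcount D s : ℤ)) (fun s _ => ?_) h2 hs
    rw [Int.toNat_natCast]
    exact_mod_cast hD.minusMinus_hcount_le s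
  · rcases hs.eq_or_lt with rfl | hs
    · rwa [fmin_of_le _ le_rfl]
    · rw [fmin_of_le _ hs.le, h1 _ hs]

theorem exists_hcount_union_lexCo {n s a : ℕ} (N : Set (Fin n → ℕ)) (hN : hcount N s ≤ a)
    (ha : a ≤ n.multichoose s) : ∃ c ≤ a, hcount (N ∪ lexCo n s c) s = a := by
  have hex : ∃ c ≤ a, a ≤ hcount (N ∪ lexCo n s c) s :=
    ⟨a, le_rfl, (hcount_lexCo ha).symm.le.trans (hcount_mono fun _ _ h => Or.inr h)⟩
  obtain ⟨h1, h2⟩ := Nat.find_spec hex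
  refine ⟨Nat.find hex, h1, le_antisymm ?_ h2⟩
  rcases Nat.eq_zero_or_eq_succ_pred (Nat.find hex) with h | h
  · rw [h]
    refine le_trans (hcount_mono fun μ hμ h => ?_) hN
    refine h.resolve_right fun h => ?_
    have h3 := hcount_lexCo (Nat.zero_le (n.multichoose s))
    rw [hcount, Set.ncard_eq_zero (finite_degree _ _)] at h3
    exact (Set.ext_iff.1 h3 μ).1 ⟨hμ, h⟩
  · set c := (Nat.find hex).pred
    have h3 : hcount (N ∪ lexCo n s c) s < a := by
      by_contra! h3
      have := Nat.find_min' hex ⟨by omega, h3⟩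
      omega
    have h4 : hcount (N ∪ lexCo n s (c + 1)) s ≤
        hcount (N ∪ lexCo n s c) s + hcount (lexCo n s (c + 1) \ lexCo n s c) s := by
      refine le_trans (Set.ncard_le_ncard ?_ ((finite_degree _ _).union (finite_degree _ _)))
        (Set.ncard_union_le _ _)
      rintro μ ⟨hμ, h | h⟩
      · exact Or.inl ⟨hμ, Or.inl h⟩
      · by_cases h' : μ ∈ lexCo n s c
        · exact Or.inl ⟨hμ, Or.inr h'⟩
        · exact Or.inr ⟨hμ, h, h'⟩
    have h5 : hcount (lexCo n s (c + 1) \ lexCo n s c) s + hcount (lexCo n s c) s =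
        hcount (lexCo n s (c + 1)) s := by
      have h6 := Set.ncard_sdiff_add_ncard_of_subset
        (s := {μ : Fin n → ℕ | ∑ i, μ i = s ∧ μ ∈ lexCo n s c})
        (t := {μ : Fin n → ℕ | ∑ i, μ i = s ∧ μ ∈ lexCo n s (c + 1)})
        (fun μ hμ => ⟨hμ.1, lexCo_mono n s (Nat.le_succ c) hμ.2⟩) (finite_degree _ _)
      rw [hcount, hcount, hcount, ← h6]
      congr 2
      ext μ
      simp only [Set.mem_sdiff, Set.mem_ofPred_eq]
      tauto
    rw [hcount_lexCo (by omega), hcount_lexCo (by omega)] at h5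
    rw [h]
    change hcount (N ∪ lexCo n s (c + 1)) s ≤ a
    omega

/-- Enlarging the complement of an ideal in degrees at most `l` by lex-segment complements. -/
theorem exists_enlarge {n l : ℕ} {N : Set (Fin n → ℕ)} (hN : StableCompl N)
    (hg : GenLE (l + 1) N) {w : ℕ → ℕ} (hw : ∀ s, s < l → minusMinus (w (s + 1)) (s + 1) ≤ w s)
    (hb : ∀ s, s ≤ l → w s ≤ n.multichoose s)
    (hlex : ∀ s, s < l → ∀ μ ∈ N, ∑ i, μ i = s → μ ∈ lexCo n s (w s))
    (hle : hcount N l ≤ w l) (heq : ∀ s, l < s → hcount N s = w s) :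
    ∃ D : Set (Fin n → ℕ), StableCompl D ∧ GenLE (l + 1) D ∧ (∀ s, hcount D s = w s) ∧
      ∀ s, s < l → ∀ μ ∈ D, ∑ i, μ i = s → μ ∈ lexCo n s (w s) := by
  obtain ⟨c, hc, hcw⟩ := exists_hcount_union_lexCo N hle (hb l le_rfl)
  have hD : ∃ D : Set (Fin n → ℕ), (∀ μ, ∑ i, μ i < l → (μ ∈ D ↔ μ ∈ lexCo n (∑ i, μ i) (w (∑ i, μ i))))
      ∧ (∀ μ, ∑ i, μ i = l → (μ ∈ D ↔ μ ∈ N ∪ lexCo n l c)) ∧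
      ∀ μ, l < ∑ i, μ i → (μ ∈ D ↔ μ ∈ N) := by
    refine ⟨{μ | (∑ i, μ i < l ∧ μ ∈ lexCo n (∑ i, μ i) (w (∑ i, μ i))) ∨
      (∑ i, μ i = l ∧ μ ∈ N ∪ lexCo n l c) ∨ (l < ∑ i, μ i ∧ μ ∈ N)}, ?_, ?_, ?_⟩
    all_goals
      intro μ hμ
      simp only [Set.mem_ofPred_eq]
      have h1 := lt_trichotomy (∑ i, μ i) l
      constructor
    · rintro (h | h | h)
      · exact h.2
      · omega
      · omega
    · exact fun h => Or.inl ⟨hμ, h⟩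
    · rintro (h | h | h)
      · omega
      · exact h.2
      · omega
    · exact fun h => Or.inr (Or.inl ⟨hμ, h⟩)
    · rintro (h | h | h)
      · omega
      · omega
      · exact h.2
    · exact fun h => Or.inr (Or.inr ⟨hμ, h⟩)
  obtain ⟨D, h1, h2, h3⟩ := hD
  refine ⟨D, ⟨?_, ?_⟩, ?_, ?_, ?_⟩
  · intro μ i hμ
    have hd := sum_add_single μ i
    rcases lt_trichotomy (∑ k, μ k + 1) l with h | h | h
    · rw [h1 _ (by omega), hd] at hμ
      rw [h1 _ (by omega)]
      exact lexCo_down (hw _ (by omega)) hμ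
    · rw [h2 _ (by omega)] at hμ
      rw [h1 _ (by omega)]
      rcases hμ with hμ | hμ
      · exact hlex _ (by omega) _ (hN.down _ _ hμ) rfl
      · rw [← h] at hμ
        refine lexCo_down ((minusMinus_mono _ ?_).trans (hw _ (by omega))) hμ
        rw [h]
        exact hc
    · rw [h3 _ (by omega)] at hμ
      have := hN.down _ _ hμ
      rcases (Nat.lt_succ_iff.1 h).eq_or_lt with h | h
      · rw [h2 _ h.symm]
        exact Or.inl this
      · rwa [h3 _ h]
  · intro μ i j hij hμ
    have hd := sum_add_single μ i
    have hd' := sum_add_single μ j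
    rcases lt_trichotomy (∑ k, μ k + 1) l with h | h | h
    · rw [h1 _ (by omega), hd] at hμ
      rw [h1 _ (by omega), hd']
      exact lexCo_borel hij hμ
    · rw [h2 _ (by omega)] at hμ ⊢
      exact hμ.imp (hN.borel _ _ _ hij) (lexCo_borel hij)
    · rw [h3 _ (by omega)] at hμ ⊢
      exact hN.borel _ _ _ hij hμ
  · intro μ hμ hμ'
    rw [h3 _ (by omega)]
    refine hg μ hμ fun ν i hν => ?_
    have := hμ' ν i hν
    rwa [h3 _ (by rw [hν, sum_add_single] at hμ; omega)] at this
  · intro s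
    rcases lt_trichotomy s l with h | rfl | h
    · rw [← hcount_lexCo (hb s h.le)]
      refine hcount_congr fun μ hμ => ?_
      rw [h1 _ (by omega), hμ]
    · rw [← hcw]
      exact hcount_congr h2
    · rw [← heq s h]
      exact hcount_congr fun μ hμ => h3 μ (by omega)
  · intro s hs μ hμ hd
    rw [h1 _ (by omega), hd] at hμ
    exact hμ

theorem le_multichoose {w : ℕ → ℕ} {l n : ℕ}
    (hw : ∀ s, s < l → minusMinus (w (s + 1)) (s + 1) ≤ w s) (h0 : w 0 ≤ 1) (h1 : w 1 ≤ n)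
    (hn : 1 ≤ n) {s : ℕ} (hs : s ≤ l) : w s ≤ n.multichoose s := by
  induction s with
  | zero => simpa using h0
  | succ s ih =>
    obtain _ | s := s
    · simpa using h1
    · have h2 := (le_plusPlus_iff (show 1 ≤ s + 1 by omega)).2 (hw (s + 1) (by omega))
      have h3 := (plusPlus_strictMono (show 1 ≤ s + 1 by omega)).monotone (ih (by omega))
      refine h2.trans (h3.trans ?_)
      rw [Nat.multichoose_eq, Nat.multichoose_eq, plusPlus_choose (by omega)]
      apply le_of_eq
      congr 1

/-- The minimal function of `q` with regularity at most `l` is realized by strongly stable ideals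
generated in degrees at most `l + 1`, which are lex-segments in degrees less than `l`. -/
def RealizesMin (q : GotzmannPoly) (l : ℕ) : Prop :=
  ∃ n₀, ∀ n, n₀ ≤ n → ∃ N : Set (Fin n → ℕ), StableCompl N ∧ GenLE (l + 1) N ∧
    (∀ s, (hcount N s : ℤ) = fmin q l s) ∧
    ∀ s, s < l → ∀ μ ∈ N, ∑ i, μ i = s → μ ∈ lexCo n s (fmin q l s).toNat

theorem RealizesMin.exists_of_fmin_le {q : GotzmannPoly} {l : ℕ} (h : RealizesMin q l)
    {w : ℕ → ℤ} (hw : ∀ s, s < l → (minusMinus (w (s + 1)).toNat (s + 1) : ℤ) ≤ w s)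
    (h0 : w 0 ≤ 1) (hl : q.eval l ≤ w l) (heq : ∀ t, l < t → w t = q.eval t) :
    ∃ n₀, ∀ n, n₀ ≤ n → ∃ N : Set (Fin n → ℕ), StableCompl N ∧ GenLE (l + 1) N ∧
      (∀ s, (hcount N s : ℤ) = w s) ∧
      ∀ s, s < l → ∀ μ ∈ N, ∑ i, μ i = s → μ ∈ lexCo n s (w s).toNat := by
  obtain ⟨n₀, hn₀⟩ := h
  refine ⟨max n₀ (max (w 1).toNat 1), fun n hn => ?_⟩
  obtain ⟨N, h1, h2, h3, h4⟩ := hn₀ n (by omega)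
  have hle : ∀ s, s ≤ l → fmin q l s ≤ w s := fun s hs => fmin_le hw hl hs
  have hpos : ∀ s, 0 ≤ w s := by
    intro s
    rcases le_or_gt s l with hs | hs
    · exact (by positivity : (0 : ℤ) ≤ (hcount N s : ℤ)).trans ((h3 s).le.trans (hle s hs))
    · rw [heq s hs, ← fmin_of_le q hs.le, ← h3]
      positivity
  have hw' : ∀ s, s < l → minusMinus (w (s + 1)).toNat (s + 1) ≤ (w s).toNat := by
    intro s hs
    have := hw s hs
    omega
  obtain ⟨D, g1, g2, g3, g4⟩ := exists_enlarge h1 h2 (w := fun s => (w s).toNat) hw'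
    (fun s hs => le_multichoose (w := fun s => (w s).toNat) hw' (by simpa using h0) (by omega)
      (by omega) hs)
    (fun s hs μ hμ hd => lexCo_mono n s (Int.toNat_le_toNat (hle s hs.le)) (h4 s hs μ hμ hd))
    (by have := hle l le_rfl; have := h3 l; omega)
    (fun s hs => by have := h3 s; rw [fmin_of_le q hs.le, ← heq s hs] at this; omega)
  refine ⟨D, g1, g2, fun s => ?_, g4⟩
  rw [g3]
  have := hpos s
  omega

theorem realizesMin_of_persistAt {q : GotzmannPoly} {l : ℕ} (hl : 1 ≤ l) (h : PersistAt q l) :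
    (∀ t : ℕ, l ≤ t → 0 ≤ q.eval t) ∧ RealizesMin q l := by
  obtain ⟨d, hd⟩ : ∃ d, (q.deltaIter d).ks = [] :=
    ⟨q.degree + 1, GotzmannPoly.deltaIter_eq_nil (by omega)⟩
  induction d generalizing q with
  | zero =>
    have hq : q.ks = [] := hd
    have hf : ∀ s, s ≤ l → fmin q l s ≤ 0 := fun s hs =>
      fmin_le (w := fun _ => 0) (by simp) (by simp [GotzmannPoly.eval_of_nil hq]) hs
    refine ⟨fun t _ => by rw [GotzmannPoly.eval_of_nil hq], 0, fun n _ => ⟨∅, ⟨?_, ?_⟩, ?_, ?_, ?_⟩⟩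
    · exact fun _ _ h => h.elim
    · exact fun _ _ _ _ h => h.elim
    · intro μ hμ hμ'
      obtain ⟨i, hi⟩ : ∃ i, 1 ≤ μ i := exists_one_le_of_sum_pos (by omega)
      obtain ⟨ν, hν⟩ := exists_eq_add_single hi
      exact hμ' ν i hν
    · intro s
      have h1 : hcount (∅ : Set (Fin n → ℕ)) s = 0 := by simp [hcount]
      rw [h1]
      rcases lt_or_ge s l with hs | hs
      · have h2 := hf s hs.le
        rw [fmin_of_lt q hs] at h2 ⊢
        omega
      · rw [fmin_of_le q hs, GotzmannPoly.eval_of_nil hq]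
        rfl
    · exact fun _ _ _ h => h.elim
  | succ d ih =>
    rw [GotzmannPoly.deltaIter_succ'] at hd
    obtain ⟨hpos', hR⟩ := ih h.delta hd
    obtain ⟨⟨h1, h2⟩, -⟩ := persistAt_iff.1 h
    have hpos : ∀ t : ℕ, l ≤ t → 0 ≤ q.eval t := by
      intro t ht
      induction t, ht using Nat.le_induction with
      | base => exact h1
      | succ t ht iht =>
        rw [GotzmannPoly.eval_succ]
        have := hpos' (t + 1) (by omega)
        omega
    refine ⟨hpos, ?_⟩
    have hfpos : ∀ s, 0 ≤ fmin q l s := by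
      intro s
      rcases lt_or_ge s l with hs | hs
      · rw [fmin_of_lt q hs]
        positivity
      · rw [fmin_of_le q hs]
        exact hpos s hs
    have hQ : ∀ s, s < l → minusMinus (fmin q l (s + 1)).toNat (s + 1) = (fmin q l s).toNat := by
      intro s hs
      have := fmin_of_lt q hs
      omega
    obtain ⟨w, hw0, hws⟩ : ∃ w : ℕ → ℤ, w 0 = fmin q l 0 ∧
        ∀ s, w (s + 1) = fmin q l (s + 1) - fmin q l s :=
      ⟨fun s => Nat.casesOn s (fmin q l 0) fun s => fmin q l (s + 1) - fmin q l s, rfl,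
        fun s => rfl⟩
    have hwQ : ∀ s, s < l → (minusMinus (w (s + 1)).toNat (s + 1) : ℤ) ≤ w s := by
      intro s hs
      have g1 := minusMinus_sub_le (fmin q l (s + 1)).toNat s
      have g2 := hfpos (s + 1)
      have g3 := hfpos s
      have g4 := minusMinus_le (fmin q l s).toNat s
      have g5 : (w (s + 1)).toNat = (fmin q l (s + 1)).toNat - (fmin q l s).toNat := by
        have := hws s
        omega
      rw [hQ s hs, ← g5] at g1
      obtain _ | s := s
      · simp only [minusMinus_base] at g1
        omega
      · rw [hQ s (by omega)] at g1
        have := hws s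
        have := hfpos s
        rw [hQ s (by omega)] at g4
        omega
    have hw01 : w 0 ≤ 1 := by
      rw [hw0, fmin_of_lt q hl]
      exact_mod_cast minusMinus_one_le _
    have hwl : q.delta.eval l ≤ w l := by
      obtain _ | l := l
      · omega
      · rw [hws, fmin_of_lt q (Nat.lt_succ_self l), fmin_of_le q le_rfl]
        omega
    have hwt : ∀ t, l < t → w t = q.delta.eval t := by
      intro t ht
      obtain _ | t := t
      · omega
      · rw [hws, fmin_of_le q (by omega), fmin_of_le q (by omega), GotzmannPoly.eval_succ]
        ring
    obtain ⟨n₀, hn₀⟩ := hR.exists_of_fmin_le hwQ hw01 hwl hwt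
    refine ⟨n₀ + 1, fun n hn => ?_⟩
    obtain _ | n := n
    · omega
    obtain ⟨D, g1, g2, g3, g4⟩ := hn₀ n (by omega)
    refine ⟨coneE D, g1.coneE, g2.coneE, fun s => ?_, fun s hs ν hν hd => ?_⟩
    · induction s with
      | zero => rw [hcount_coneE_zero, g3, hw0]
      | succ s ihs =>
        rw [hcount_coneE_succ]
        push_cast
        rw [g3, ihs, hws]
        ring
    · obtain ⟨c, μ, rfl⟩ := consE_surj ν
      rw [sum_consE] at hd
      refine (consE_mem_lexCo_iff (S := l) (F := fun s => (fmin q l s).toNat)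
        (w := fun s => (w s).toNat) (by simp [hw0]) hQ (fun s hs => ?_) hs.le).2
        ⟨by omega, g4 _ (by omega) _ hν (by omega)⟩
      have := hws s
      have := hfpos s
      have := hQ s hs
      have := minusMinus_le (fmin q l (s + 1)).toNat (s + 1)
      omega

theorem borelStep_add_single {n : ℕ} (μ : Mon n) {i j : Fin (n + 1)} (h : j ≠ i) :
    borelStep (μ + Pi.single j 1) j i = μ + Pi.single i 1 := by
  ext l
  simp only [borelStep, Pi.add_apply]
  split_ifs with h1 h2
  · subst h1
    simp [h]
  · subst h2
    simp [h1]
  · simp [h1, h2]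

theorem shrinkAt_add_single {n : ℕ} (μ : Mon n) (i : Fin (n + 1)) :
    shrinkAt (μ + Pi.single i 1) i = μ := by
  ext l
  simp only [shrinkAt, Pi.add_apply]
  split_ifs with h1
  · subst h1
    simp
  · simp [h1]

theorem StableCompl.stronglyStable {n : ℕ} {N : Set (Mon n)} (h : StableCompl N) :
    StronglyStable Nᶜ := by
  refine ⟨fun m hm m' hm' => hm (h.down_add _ _ hm'), fun m hm j i hij hj hm' => hm ?_⟩
  obtain ⟨ν, rfl⟩ := exists_eq_add_single hj
  rw [borelStep_add_single _ hij.ne] at hm'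
  exact h.borel _ i j hij.le hm'

theorem StronglyStable.stableCompl {n : ℕ} {J : Set (Mon n)} (h : StronglyStable J) :
    StableCompl Jᶜ := by
  refine ⟨fun μ i hμ hμ' => hμ (h.1 _ hμ' _), fun μ i j hij hμ hμ' => hμ ?_⟩
  rcases hij.eq_or_lt with rfl | hij
  · exact hμ'
  · have := h.2 _ hμ' j i hij (by simp)
    rwa [borelStep_add_single _ hij.ne] at this

theorem finite_isMinGen {n : ℕ} {J : Set (Mon n)} (h : MonIdeal J) : {m | IsMinGen J m}.Finite := by
  refine WellQuasiOrderedLE.finite_of_isAntichain (s := {m | IsMinGen J m}) ?_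
  · intro a ha b hb hab hle
    obtain ⟨c, rfl⟩ := exists_add_of_le hle
    obtain ⟨i, hi⟩ : ∃ i, 1 ≤ c i := by
      by_contra! hc
      apply hab
      ext i
      simpa using hc i
    obtain ⟨d, rfl⟩ := exists_eq_add_single hi
    apply hb.2 i (by simp only [Pi.add_apply, Pi.single_eq_same]; omega)
    rw [← add_assoc, shrinkAt_add_single]
    exact h _ ha.1 _

theorem StronglyStable.genLE {n : ℕ} {J : Set (Mon n)} (h : StronglyStable J) :
    GenLE (monReg J) Jᶜ := by
  intro μ hμ hμ' hμJ
  refine not_le.2 hμ (le_csSup ?_ ⟨μ, ⟨hμJ, fun i hi hs => ?_⟩, rfl⟩)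
  · exact ((finite_isMinGen h.1).image mdeg).bddAbove
  · obtain ⟨ν, rfl⟩ := exists_eq_add_single hi
    rw [shrinkAt_add_single] at hs
    exact hμ' ν i rfl hs

theorem monReg_compl_le {n m : ℕ} {N : Set (Mon n)} (hg : GenLE m N) : monReg Nᶜ ≤ m := by
  refine csSup_le' ?_
  rintro _ ⟨μ, ⟨h1, h2⟩, rfl⟩
  by_contra! hm
  refine h1 (hg μ hm fun ν i hν => ?_)
  have := h2 i (by simp [hν])
  rw [hν, shrinkAt_add_single] at this
  exact not_not.1 this

theorem coneE_sect_of_monSat {n : ℕ} {J : Set (Mon n)} (h : StronglyStable J) (hs : monSat J = J) :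
    coneE (sect Jᶜ) = Jᶜ := by
  have hN := h.stableCompl
  have key : ∀ ν ∈ Jᶜ, ν + Pi.single 0 1 ∈ Jᶜ := by
    intro ν hν hν'
    apply hν
    rw [← hs]
    intro i
    refine ⟨1, ?_⟩
    have : (fun l => if l = i then ν l + 1 else ν l) = ν + Pi.single i 1 := by
      ext l
      split_ifs with hl
      · simp [hl]
      · simp [hl]
    rw [this]
    rcases eq_or_ne i 0 with rfl | hi
    · exact hν'
    · have := h.2 _ hν' 0 i (Fin.pos_of_ne_zero hi) (by simp)
      rwa [borelStep_add_single _ hi.symm] at this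
  ext ν
  obtain ⟨c, μ, rfl⟩ := consE_surj ν
  rw [mem_coneE]
  change consE 0 μ ∈ Jᶜ ↔ _
  induction c with
  | zero => rfl
  | succ c ih =>
    rw [ih, ← consE_add_zero]
    exact ⟨key _, hN.down _ _⟩

theorem monSat_compl_coneE {n : ℕ} (D : Set (Fin n → ℕ)) : monSat (coneE D)ᶜ = (coneE D)ᶜ := by
  ext ν
  constructor
  · intro h
    obtain ⟨c, hc⟩ := h 0
    obtain ⟨a, μ, rfl⟩ := consE_surj ν
    have : (fun l => if l = 0 then consE a μ l + c else consE a μ l) = consE (a + c) μ := by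
      ext l
      refine Fin.cases ?_ (fun l => ?_) l
      · simp
      · simp [consE, Fin.succ_ne_zero]
    rw [this] at hc
    exact hc
  · intro h i
    refine ⟨0, ?_⟩
    simpa using h

theorem hilb_compl {n : ℕ} (N : Set (Mon n)) (t : ℕ) : hilb Nᶜ t = hcount N t := by
  simp [hilb, hcount, mdeg]

/-- There is a strongly stable ideal generated in degrees at most `m` whose quotient has Hilbert
function the first difference of `u`. -/
def Attains (u : ℕ → ℤ) (m : ℕ) : Prop :=
  ∃ (n : ℕ) (D : Set (Fin n → ℕ)), StableCompl D ∧ GenLE m D ∧ ∀ t, (hcount D t : ℤ) = nderiv u t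

theorem GenLE.of_coneE {n m : ℕ} {D : Set (Fin n → ℕ)} (h : StableCompl D)
    (hg : GenLE m (_root_.coneE D)) : GenLE m D := by
  have h' := hg.satSec h.coneE
  have : _root_.satSec (_root_.coneE D) = D := by
    ext μ
    exact ⟨fun h => h 0, fun h _ => h⟩
  rwa [this] at h'

theorem hcount_coneE_eq {u : ℕ → ℤ} (hu : u 0 = 1) {n : ℕ} {D : Set (Fin n → ℕ)}
    (h : ∀ t, (hcount D t : ℤ) = nderiv u t) (t : ℕ) : (hcount (coneE D) t : ℤ) = u t := by
  induction t with
  | zero => rw [hcount_coneE_zero, h, hu]; rfl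
  | succ t ih =>
    rw [hcount_coneE_succ]
    push_cast
    rw [ih, h, nderiv]
    ring

theorem mReg_spec {u : ℕ → ℤ} (hu : u 0 = 1) {m : ℕ} (h : Attains u m) :
    mReg u ≤ m ∧ Attains u (mReg u) := by
  obtain ⟨n, D, h1, h2, h3⟩ := h
  have hD : ∀ t, (hilb (coneE D)ᶜ t : ℤ) = u t := by
    intro t
    rw [hilb_compl, hcount_coneE_eq hu h3]
  have hmem : monReg (coneE D)ᶜ ∈ {r | ∃ (n : ℕ) (J : Set (Mon n)), StronglyStable J ∧
      monSat J = J ∧ (∀ t : ℕ, (hilb J t : ℤ) = u t) ∧ monReg J = r} :=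
    ⟨n, _, h1.coneE.stronglyStable, monSat_compl_coneE D, hD, rfl⟩
  refine ⟨(Nat.sInf_le hmem).trans (monReg_compl_le h2.coneE), ?_⟩
  obtain ⟨n', J, g1, g2, g3, g4⟩ := Nat.sInf_mem ⟨_, hmem⟩
  have g5 := coneE_sect_of_monSat g1 g2
  have g6 : StableCompl (sect Jᶜ) := g1.stableCompl.sect
  refine ⟨n', sect Jᶜ, g6, ?_, ?_⟩
  · apply GenLE.of_coneE g6
    rw [g5]
    change GenLE (sInf _) _
    rw [← g4]
    exact g1.genLE
  · have g7 : ∀ t, (hcount (coneE (sect Jᶜ)) t : ℤ) = u t := by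
      intro t
      rw [g5, ← hilb_compl, compl_compl, g3]
    intro t
    obtain _ | t := t
    · rw [← hcount_coneE_zero, g7, hu]
      rfl
    · rw [nderiv, ← g7, ← g7, hcount_coneE_succ]
      push_cast
      ring

theorem exists_hcount_coneE_eq_choose {n : ℕ} {D : Set (Fin n → ℕ)} (h : StableCompl D)
    (hg : GenLE 1 D) (h0 : 0 ∈ D) : ∃ d, ∀ t, hcount (coneE D) t = (t + d).choose d := by
  induction n with
  | zero =>
    refine ⟨0, fun t => ?_⟩
    induction t with
    | zero => rw [hcount_coneE_zero, hcount_zero, if_pos h0, Nat.choose_zero_right]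
    | succ t ih => rw [hcount_coneE_succ, hcount_no_vars, ih]; simp
  | succ n ih =>
    by_cases he : (0 + Pi.single 0 1 : Fin (n + 1) → ℕ) ∈ D
    · have hs : ∀ c, consE c (0 : Fin n → ℕ) ∈ D := by
        have hz : consE 0 (0 : Fin n → ℕ) = 0 := by
          ext i
          exact Fin.cases rfl (fun i => rfl) i
        intro c
        induction c with
        | zero => rwa [hz]
        | succ c ih =>
          rw [← consE_add_zero]
          obtain _ | c := c
          · rwa [hz]
          · exact hg.add_single_zero h ih (by rw [sum_consE]; omega)
      have hD : coneE (satSec D) = D := by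
        refine subset_antisymm coneE_satSec_subset fun ν hν => ?_
        rcases Nat.eq_zero_or_pos (∑ i, ν i) with h1 | h1
        · have : ν = 0 := by
            ext i
            simpa using (Finset.sum_eq_zero_iff.1 h1) i
          rw [this]
          exact hs
        · exact mem_coneE_satSec hg h hν h1
      obtain ⟨d, hd⟩ := ih h.satSec (hg.satSec h) hs
      rw [hD] at hd
      refine ⟨d + 1, fun t => ?_⟩
      induction t with
      | zero => simp [hcount_coneE_zero, hd]
      | succ t ih =>
        rw [hcount_coneE_succ, hd, ih, show t + 1 + (d + 1) = (t + 1 + d) + 1 by ring,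
          Nat.choose_succ_succ, show t + (d + 1) = t + 1 + d by ring]
    · have hD : ∀ t, hcount D (t + 1) = 0 := by
        intro t
        unfold hcount
        convert Set.ncard_empty (Fin (n + 1) → ℕ)
        ext μ
        simp only [Set.mem_ofPred_eq, Set.mem_empty_iff_false, iff_false, not_and]
        intro h1 hμ
        obtain ⟨i, hi⟩ : ∃ i, 1 ≤ μ i := exists_one_le_of_sum_pos (by omega)
        obtain ⟨ν, rfl⟩ := exists_eq_add_single hi
        refine he (h.down_add _ ν ?_)
        rw [zero_add (Pi.single _ _), add_comm (Pi.single _ _) ν]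
        exact h.borel ν i 0 (Fin.zero_le _) hμ
      refine ⟨0, fun t => ?_⟩
      induction t with
      | zero => rw [hcount_coneE_zero, hcount_zero, if_pos h0, Nat.choose_zero_right]
      | succ t ih => simp [hcount_coneE_succ, hD, ih]

theorem Attains.eq_choose {u : ℕ → ℤ} (hu : u 0 = 1) {m : ℕ} (h : Attains u m) (hm : m ≤ 1) :
    ∃ d : ℕ, ∀ t : ℕ, u t = (t + d).choose d := by
  obtain ⟨n, D, h1, h2, h3⟩ := h
  have h0 : 0 ∈ D := by
    by_contra h0
    have := h3 0
    rw [h1.hcount_eq_zero h0] at this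
    simp [nderiv] at this
  obtain ⟨d, hd⟩ := exists_hcount_coneE_eq_choose h1 (h2.mono hm) h0
  exact ⟨d, fun t => by rw [← hcount_coneE_eq hu h3, hd]⟩

theorem attains_of_persistAt {u : ℕ → ℤ} {q : GotzmannPoly} {l : ℕ} (hl : 1 ≤ l)
    (h : PersistAt q l) (hu : OSeq (nderiv u)) (hql : q.eval l ≤ nderiv u l)
    (heq : ∀ t : ℕ, l < t → nderiv u t = q.eval t) : Attains u (l + 1) := by
  obtain ⟨n, hn⟩ := (realizesMin_of_persistAt hl h).2.exists_of_fmin_le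
    (fun s _ => hu.minusMinus_le s) hu.2.1.le hql heq
  obtain ⟨N, h1, h2, h3, -⟩ := hn n le_rfl
  exact ⟨n, N, h1, h2, h3⟩

theorem nderiv_eq_eval_delta {p : GotzmannPoly} {u : ℕ → ℤ} {l : ℕ}
    (h : ∀ t : ℕ, l ≤ t → u t = p.eval t) {t : ℕ} (ht : l < t) : nderiv u t = p.delta.eval t := by
  obtain _ | t := t
  · omega
  rw [nderiv, h _ ht.le, h _ (by omega), GotzmannPoly.eval_succ]
  ring

theorem eq_eval_of_nderiv {p : GotzmannPoly} {u : ℕ → ℤ} {l N : ℕ}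
    (hN : ∀ t : ℕ, N ≤ t → u t = p.eval t)
    (h : ∀ t : ℕ, l < t → nderiv u t = p.delta.eval t) {t : ℕ} (ht : l ≤ t) : u t = p.eval t := by
  refine eq_eval_of_succ hN (l := l) (fun t ht => ?_) ht
  rw [← h (t + 1) (by omega), nderiv]
  ring

theorem persistAt_of_length_le {q : GotzmannPoly} {l : ℕ} (h : q.ks.length ≤ l) :
    PersistAt q (l + 1) := by
  intro i
  have hi := (q.length_deltaIter_le i).trans h
  refine ⟨GotzmannPoly.eval_nonneg _ (by omega), ?_⟩
  have h1 := GotzmannPoly.minusMinus_eval_le _ hi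
  have h2 := GotzmannPoly.eval_succ (q.deltaIter i) l
  rw [GotzmannPoly.deltaIter_succ]
  linarith

theorem persistAt_of_Fset {q : GotzmannPoly} {M : ℕ}
    (h : ∀ i, (q.deltaIter i).ks ≠ [] → ∃ ρ ≤ M, (Fset (q.deltaIter i) ρ).Nonempty) :
    PersistAt q (M + 1) := by
  intro i
  by_cases hi : (q.deltaIter i).ks = []
  · rw [GotzmannPoly.deltaIter_succ, GotzmannPoly.eval_of_nil hi,
      GotzmannPoly.eval_of_nil (GotzmannPoly.delta_of_nil hi)]
    simp
  obtain ⟨ρ, hρ, G, hG, -, hreg, -⟩ := h i hi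
  have h1 := hG.minusMinus_le M
  have h2 := GotzmannPoly.eval_succ (q.deltaIter i) M
  rw [hreg M hρ, hreg (M + 1) (by omega)] at h1
  refine ⟨?_, ?_⟩
  · rw [← hreg (M + 1) (by omega)]
    exact hG.1 _
  · rw [GotzmannPoly.deltaIter_succ]
    linarith

theorem OSeq.pos_of_le {G : ℕ → ℤ} (hG : OSeq G) {s t : ℕ} (hst : s ≤ t) (h : 0 < G t) :
    0 < G s := by
  induction t, hst using Nat.le_induction with
  | base => exact h
  | succ t ht ih =>
    apply ih
    have h1 := hG.minusMinus_le t
    have h2 := minusMinus_pos (a := (G (t + 1)).toNat) (t := t) (by omega)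
    omega

theorem fmin_zero_of_mem_Fset {q : GotzmannPoly} (hq : q.ks ≠ []) {ρ t : ℕ} {G : ℕ → ℤ}
    (hG : G ∈ Fset q ρ) (ht : ρ ≤ t) : fmin q t 0 = 1 := by
  obtain ⟨h1, h2, h3, -⟩ := hG
  apply le_antisymm
  · rw [← h1.2.1]
    exact fmin_le (fun s _ => h1.minusMinus_le s) (h3 t ht).ge (Nat.zero_le _)
  · have h4 : 0 < q.eval t := by
      rw [← h3 t ht]
      refine h1.pos_of_le (t := t + q.ks.length) (by omega) ?_
      rw [h3 _ (by omega)]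
      exact GotzmannPoly.eval_pos hq (by omega)
    have h5 : ∀ j s, s + j = t → 0 < fmin q t s := by
      intro j
      induction j with
      | zero =>
        intro s hs
        rwa [fmin_of_le _ (by omega), show s = t by omega]
      | succ j ih =>
        intro s hs
        have h6 := ih (s + 1) (by omega)
        rw [fmin_of_lt _ (by omega)]
        have := minusMinus_pos (a := (fmin q t (s + 1)).toNat) (t := s) (by omega)
        omega
    have := h5 t 0 (by omega)
    omega

theorem oSeq_nderiv_fmin {q : GotzmannPoly} {ρ t : ℕ} {G : ℕ → ℤ}
    (hG : G ∈ Fset q ρ) (ht : ρ ≤ t) : OSeq (nderiv (fmin q t)) := by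
  obtain ⟨h1, h2, h3, -⟩ := hG
  have hfG : ∀ s, t ≤ s → fmin q t s = G s := fun s hs => by
    rw [fmin_of_le _ hs, h3 _ (by omega)]
  have hw : ∀ s, t < s → nderiv (fmin q t) s = nderiv G s := by
    intro s hs
    obtain _ | s := s
    · omega
    rw [nderiv, nderiv, hfG _ (by omega), hfG _ (by omega)]
  refine oSeq_of_minusMinus_le rfl fun s => ?_
  obtain _ | s := s
  · change ((minusMinus _ 1 : ℕ) : ℤ) ≤ 1
    exact_mod_cast minusMinus_one_le _
  rcases lt_trichotomy (s + 1) t with hs | hs | hs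
  · rw [nderiv, nderiv, fmin_of_lt q (show s < t by omega), fmin_of_lt q hs, Int.toNat_natCast]
    set c := (fmin q t (s + 1 + 1)).toNat with hc
    have hc0 : fmin q t (s + 1 + 1) = c := by
      have : 0 ≤ fmin q t (s + 1 + 1) := by
        rcases le_or_gt t (s + 1 + 1) with h | h
        · rw [hfG _ h]
          exact h1.1 _
        · rw [fmin_of_lt _ h]
          positivity
      omega
    rw [hc0]
    have k1 := minusMinus_sub_le c (s + 1)
    have k2 := minusMinus_le c (s + 1 + 1)
    have k3 := minusMinus_le (minusMinus c (s + 1 + 1)) (s + 1)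
    rw [show ((c : ℤ) - (minusMinus c (s + 1 + 1) : ℕ)).toNat = c - minusMinus c (s + 1 + 1) by omega]
    omega
  · rw [hw _ (by omega)]
    have k1 := h2.minusMinus_le (s + 1)
    have k2 := h1.minusMinus_le s
    rw [nderiv] at k1
    rw [show nderiv (fmin q t) (s + 1) = fmin q t (s + 1) - fmin q t s from rfl,
      fmin_of_lt q (show s < t by omega), hfG _ hs.ge]
    rw [nderiv] at *
    linarith
  · rw [hw _ (by omega), hw _ hs]
    exact h2.minusMinus_le _

theorem two_le_of_attains {p : GotzmannPoly} (hr : 1 < p.r) {ρ : ℕ} {u : ℕ → ℤ} (hu : u ∈ Fset p ρ)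
    {m : ℕ} (h : Attains u m) : 2 ≤ m := by
  by_contra! hm
  obtain ⟨d, hd⟩ := h.eq_choose hu.1.2.1 (by omega)
  have hp := GotzmannPoly.eq_singleton_of_eventually (p := p) (d := d) (N := ρ) fun t ht => by
    rw [← hu.2.2.1 t ht, hd]
  rw [GotzmannPoly.r, hp] at hr
  simp at hr

theorem two_le_max {p : GotzmannPoly} (hr : 1 < p.r) {ρ : ℕ} {u : ℕ → ℤ} (hu : u ∈ Fset p ρ)
    {ρt mt : ℕ} (h0 : fmin p.delta ρt 0 = 1) (h : Attains (fmin p.delta ρt) mt) :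
    2 ≤ max mt (ρ + 1) := by
  by_contra! hm
  obtain ⟨d, hd⟩ := h.eq_choose h0 (by omega)
  have hq := GotzmannPoly.eq_singleton_of_eventually (p := p.delta) (d := d) (N := ρt)
    fun t ht => by rw [← fmin_of_le _ ht, hd]
  obtain ⟨c, hc⟩ := GotzmannPoly.eq_cons_of_delta hq
  have h1 := hu.2.2.1 0 (by omega)
  rw [hu.1.2.1, GotzmannPoly.eval_zero_cons hc] at h1
  rw [GotzmannPoly.r, hc] at hr
  simp at h1 hr
  omega

/-- The data extracted from an ideal attaining the minimal regularity. -/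
theorem Attains.bounds {p : GotzmannPoly} {ρ : ℕ} {u : ℕ → ℤ} (hu : u ∈ Fset p ρ)
    {l : ℕ} (hl : 1 ≤ l) (h : Attains u (l + 1)) :
    ρ ≤ l ∧ PersistAt p.delta l ∧ (∀ s, fmin p.delta l s ≤ nderiv u s) ∧
    ∀ i, (p.delta.deltaIter i).ks ≠ [] → ∃ ρ ≤ l, (Fset (p.delta.deltaIter i) ρ).Nonempty := by
  obtain ⟨n, D, h1, h2, h3⟩ := h
  have hN : ∀ t, ρ + 1 ≤ t → (hcount D t : ℤ) = p.delta.eval t := fun t ht => by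
    rw [h3, nderiv_eq_eval_delta hu.2.2.1 (by omega)]
  obtain ⟨k1, -, k3, k4⟩ := h1.bounds hl h2 hN
  refine ⟨hu.2.2.2 l fun t ht => ?_, k3, fun s => ?_, k4⟩
  · exact eq_eval_of_nderiv hu.2.2.1 (fun t ht => by rw [← h3, k1 t ht]) ht
  · rw [← h3]
    exact h1.fmin_le hl h2 hN s

theorem attains_of_fset {p : GotzmannPoly} {ρ : ℕ} {u : ℕ → ℤ} (hu : u ∈ Fset p ρ) {l : ℕ}
    (hl : 1 ≤ l) (hρ : ρ ≤ l) (h : PersistAt p.delta l) (hle : p.delta.eval l ≤ nderiv u l) :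
    Attains u (l + 1) :=
  attains_of_persistAt hl h hu.2.1 hle fun _ ht => nderiv_eq_eval_delta hu.2.2.1 (by omega)

theorem attains_mReg {p : GotzmannPoly} {ρ : ℕ} {u : ℕ → ℤ} (hu : u ∈ Fset p ρ) :
    Attains u (mReg u) := by
  refine (mReg_spec hu.1.2.1 (attains_of_fset hu (l := max ρ p.delta.ks.length + 1) (by omega)
    (by omega) (persistAt_of_length_le (by omega)) ?_)).2
  rw [nderiv_eq_eval_delta hu.2.2.1 (by omega)]

theorem Attains.fmin {q : GotzmannPoly} {l t : ℕ} (hl : 1 ≤ l) (h : PersistAt q l) {ρ : ℕ}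
    {G : ℕ → ℤ} (hG : G ∈ Fset q ρ) (hρ : ρ ≤ t) (ht : t ≤ l) : Attains (fmin q t) (l + 1) := by
  have hev : ∀ s, t ≤ s → _root_.fmin q t s = q.eval s := fun s hs => fmin_of_le q hs
  refine attains_of_persistAt hl h.delta (oSeq_nderiv_fmin hG hρ) ?_
    fun s hs => nderiv_eq_eval_delta hev (by omega)
  rcases ht.eq_or_lt with rfl | ht
  · obtain _ | t := t
    · omega
    have h1 := (h 0).2
    rw [GotzmannPoly.deltaIter_succ, GotzmannPoly.deltaIter_zero] at h1
    rw [nderiv, fmin_of_lt q (show t < t + 1 by omega), hev _ le_rfl]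
    linarith
  · rw [nderiv_eq_eval_delta hev ht]

theorem Fset_rhobar_nonempty {q : GotzmannPoly} {l : ℕ} (h : ∃ ρ ≤ l, (Fset q ρ).Nonempty) :
    rhobar q ≤ l ∧ (Fset q (rhobar q)).Nonempty := by
  obtain ⟨ρ, h1, h2⟩ := h
  exact ⟨(Nat.sInf_le h2).trans h1, Nat.sInf_mem (s := {ρ | (Fset q ρ).Nonempty}) ⟨ρ, h2⟩⟩

/-- Theorem `construction-main`.
Let `k = deg p(z)` and `u ∈ F(p,ρ)`. Set `M = max{ρ, ρ̄_{Δ^i p} (1 ≤ i ≤ k)}`,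
`ρ̃_u = min{t ≥ ρ̄_{Δp} : f^t_{Δp} ⪯ Δu}` and `m̃ = m_{f^{ρ̃_u}_{Δp}}`.
If `k = 0` then `m_u = ρ+1`; if `k > 0` then `m_u = max{m̃, ρ+1}`. Moreover
`M + 1 ≤ m_u ≤ M + 2`. -/
theorem statement19 (p : GotzmannPoly) (hr : 1 < p.r) (ρ : ℕ)
    (u : ℕ → ℤ) (hu : u ∈ Fset p ρ)
    (k : ℕ) (hk : k = p.degree)
    (M : ℕ) (hM : M = max ρ ((Finset.Icc 1 k).sup fun i => rhobar (p.deltaIter i)))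
    (ρt : ℕ) (hρt : ρt = sInf {t : ℕ | rhobar p.delta ≤ t ∧
      ∀ s : ℕ, fmin p.delta t s ≤ nderiv u s})
    (mt : ℕ) (hmt : mt = mReg (fmin p.delta ρt)) :
    (k = 0 → mReg u = ρ + 1) ∧
    (0 < k → mReg u = max mt (ρ + 1)) ∧
    (M + 1 ≤ mReg u ∧ mReg u ≤ M + 2) := by
  subst hk hM hmt
  have hp : p.ks ≠ [] := by
    rintro h
    simp [GotzmannPoly.r, h] at hr
  have hatt := attains_mReg hu
  have h2 := two_le_of_attains hr hu hatt
  obtain ⟨l, hl⟩ : ∃ l, mReg u = l + 1 := ⟨mReg u - 1, by omega⟩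
  rw [hl] at hatt h2 ⊢
  have hl1 : 1 ≤ l := by omega
  obtain ⟨hρl, hpers, hmin, hF⟩ := hatt.bounds hu hl1
  have hbar : ∀ i ∈ Finset.Icc 1 p.degree,
      rhobar (p.deltaIter i) ≤ l ∧ (Fset (p.deltaIter i) (rhobar (p.deltaIter i))).Nonempty := by
    intro i hi
    rw [Finset.mem_Icc] at hi
    obtain ⟨i, rfl⟩ : ∃ j, i = j + 1 := ⟨i - 1, by omega⟩
    have := GotzmannPoly.deltaIter_ne_nil hp hi.2
    rw [GotzmannPoly.deltaIter_succ'] at this ⊢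
    exact Fset_rhobar_nonempty (hF i this)
  set M := max ρ ((Finset.Icc 1 p.degree).sup fun i => rhobar (p.deltaIter i)) with hM
  have hlow : M ≤ l := max_le hρl (Finset.sup_le fun i hi => (hbar i hi).1)
  have hupp : l ≤ M + 1 := by
    have hP : PersistAt p.delta (M + 1) := by
      refine persistAt_of_Fset fun i hi => ?_
      rw [← GotzmannPoly.deltaIter_succ'] at hi ⊢
      have hmem : i + 1 ∈ Finset.Icc 1 p.degree := by
        rw [Finset.mem_Icc]
        refine ⟨by omega, ?_⟩
        by_contra! h
        exact hi (GotzmannPoly.deltaIter_eq_nil h)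
      exact ⟨_, (Finset.le_sup (f := fun i => rhobar (p.deltaIter i)) hmem).trans
        (le_max_right _ _), (hbar _ hmem).2⟩
    have h := attains_of_fset hu (by omega) ((le_max_left ρ _).trans (Nat.le_succ M)) hP
      (nderiv_eq_eval_delta hu.2.2.1 (Nat.lt_succ_of_le (le_max_left ρ _))).ge
    have := (mReg_spec hu.1.2.1 h).1
    omega
  refine ⟨fun hk => ?_, fun hk => ?_, by omega, by omega⟩
  · have hks : p.ks = 0 :: List.replicate (p.r - 1) 0 := by
      rw [← List.replicate_succ, List.eq_replicate_iff]
      refine ⟨by rw [GotzmannPoly.r] at *; omega, fun b hb => ?_⟩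
      have := GotzmannPoly.le_degree hb
      omega
    have hρ : 1 ≤ ρ := by
      by_contra! h
      have h1 := hu.2.2.1 0 (by omega)
      rw [hu.1.2.1, GotzmannPoly.eval_zero_cons hks] at h1
      simp at h1
      omega
    have hnil : p.delta.ks = [] := GotzmannPoly.deltaIter_eq_nil (i := 1) (by omega)
    have h := (mReg_spec hu.1.2.1 (attains_of_fset hu hρ le_rfl (PersistAt.of_nil hnil ρ)
      (by rw [GotzmannPoly.eval_of_nil hnil]; exact hu.2.1.1 ρ))).1
    omega
  · have hq : p.delta.ks ≠ [] := GotzmannPoly.deltaIter_ne_nil hp (i := 1) hk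
    obtain ⟨hbl, G, hG⟩ := hbar 1 (Finset.mem_Icc.2 ⟨le_rfl, hk⟩)
    change rhobar p.delta ≤ l at hbl
    change G ∈ Fset p.delta (rhobar p.delta) at hG
    have hmem : l ∈ {t : ℕ | rhobar p.delta ≤ t ∧ ∀ s : ℕ, fmin p.delta t s ≤ nderiv u s} :=
      ⟨hbl, hmin⟩
    have hρtl : ρt ≤ l := hρt ▸ Nat.sInf_le hmem
    obtain ⟨hρt1, hρt2⟩ : ρt ∈ {t : ℕ | rhobar p.delta ≤ t ∧
        ∀ s : ℕ, fmin p.delta t s ≤ nderiv u s} := hρt ▸ Nat.sInf_mem ⟨_, hmem⟩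
    have hf0 := fmin_zero_of_mem_Fset hq hG hρt1
    obtain ⟨hmt, hfatt⟩ := mReg_spec hf0 (Attains.fmin hl1 hpers hG hρt1 hρtl)
    refine le_antisymm ?_ (max_le hmt (by omega))
    have hm2 := two_le_max hr hu hf0 hfatt
    obtain ⟨j, hj⟩ : ∃ j, max (mReg (fmin p.delta ρt)) (ρ + 1) = j + 1 :=
      Nat.exists_eq_add_of_le' (by omega)
    obtain ⟨n, D, d1, d2, d3⟩ := hfatt
    have hD : ∀ t, (hcount (coneE D) t : ℤ) = fmin p.delta ρt t := hcount_coneE_eq hf0 d3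
    obtain ⟨-, b2, b3, -⟩ := d1.coneE.bounds (l := j) (q := p.delta) (N := ρt) (by omega)
      (d2.coneE.mono (by omega)) fun t ht => by rw [hD, fmin_of_le _ ht]
    rw [hD] at b2
    rw [hj, ← hl]
    exact (mReg_spec hu.1.2.1
      (attains_of_fset hu (by omega) (by omega) b3 (b2.trans (hρt2 j)))).1
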